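/- arXiv:1712.01251 — 2 statements merged into one kernel-verified Lean document; each statement's English description precedes it below -/
import Mathlib

section
/- Let 𝒜 be an elliptic homogeneous constant-coefficient differential operator of order k on ℝ^n and let u ∈ L¹_loc(ℝ^n, V) be such that the distributional 𝒜u is a W-valued Radon measure on ℝ^n. Then u ∈ W^{k−1,p}_loc(ℝ^n, V) for every 1 ≤ p < n/(n−1), i.e., all distributional derivatives of u of order at most k−1 belong to L^p_loc. -/
open MeasureTheory Metric Filter
open scoped ENNReal RealInnerProductSpace Topology

noncomputable section

/-- Euclidean space `ℝ^n`. -/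
abbrev Euc (n : ℕ) : Type := EuclideanSpace ℝ (Fin n)

/-- The `i`-th standard basis vector of `ℝ^n`. -/
def stdVec (n : ℕ) (i : Fin n) : Euc n := EuclideanSpace.single i (1 : ℝ)

/-- Coefficients `A_I : V →ₗ W` (indexed by `I : Fin k → Fin n`) of a homogeneous linear
constant-coefficient differential operator `𝒜 u = ∑_I A_I ∂_I u` of order `k` on `ℝ^n`. -/
abbrev CoeffOp (n k : ℕ) (V W : Type*) [NormedAddCommGroup V] [InnerProductSpace ℝ V]
    [NormedAddCommGroup W] [InnerProductSpace ℝ W] : Type _ :=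
  (Fin k → Fin n) → (V →ₗ[ℝ] W)

variable {V W F : Type*}
  [NormedAddCommGroup V] [InnerProductSpace ℝ V] [FiniteDimensional ℝ V]
  [NormedAddCommGroup W] [InnerProductSpace ℝ W] [FiniteDimensional ℝ W]

/-- The coefficients represent a linear map on symmetric tensors `V ⊙^k ℝ^n`. -/
def IsSymmetricOp (n k : ℕ) (A : CoeffOp n k V W) : Prop :=
  ∀ (I : Fin k → Fin n) (σ : Equiv.Perm (Fin k)), A (I ∘ σ) = A I

/-- The symbol `𝒜[ξ] v = A (v ⊗^k ξ) = ∑_I (∏ i, ξ_{I i}) A_I v`. -/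
def symbolMap (n k : ℕ) (A : CoeffOp n k V W) (ξ : Euc n) : V →ₗ[ℝ] W :=
  ∑ I : Fin k → Fin n, (∏ i, ξ (I i)) • A I

/-- Ellipticity: the symbol is injective for all `ξ ≠ 0`. -/
def IsElliptic (n k : ℕ) (A : CoeffOp n k V W) : Prop :=
  ∀ ξ : Euc n, ξ ≠ 0 → Function.Injective (symbolMap n k A ξ)

/-- Van Schaftingen's cancellation condition: `⋂_{ξ ∈ 𝕊^{n-1}} im 𝒜[ξ] = {0}`. -/
def IsCanceling (n k : ℕ) (A : CoeffOp n k V W) : Prop :=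
  (⋂ ξ ∈ sphere (0 : Euc n) 1, (LinearMap.range (symbolMap n k A ξ) : Set W)) = {0}

/-- Inverse of an endomorphism (junk value when not invertible), via matrix inversion. -/
def linInv (f : V →ₗ[ℝ] V) : V →ₗ[ℝ] V :=
  letI b := Module.finBasis ℝ V
  Matrix.toLin b b ((LinearMap.toMatrix b b f)⁻¹)

/-- `𝒜†[ξ] = (𝒜*[ξ] 𝒜[ξ])⁻¹ 𝒜*[ξ]`. -/
def Adagger (n k : ℕ) (A : CoeffOp n k V W) (ξ : Euc n) : W →ₗ[ℝ] V :=
  linInv (LinearMap.adjoint (symbolMap n k A ξ) ∘ₗ symbolMap n k A ξ) ∘ₗ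
    LinearMap.adjoint (symbolMap n k A ξ)

/-- Condition (WC): for every `w ∈ ⋂_{ξ ∈ 𝕊^{n-1}} im 𝒜[ξ]`,
`∫_{𝕊^{n-1}} 𝒜†[ξ] w ⊗^{k-n} ξ dℋ^{n-1}(ξ) = 0`, written componentwise in the
tensor coordinates indexed by `J : Fin (k-n) → Fin n`. -/
def IsWeaklyCanceling (n k : ℕ) (A : CoeffOp n k V W) : Prop :=
  ∀ w : W, (∀ ξ ∈ sphere (0 : Euc n) 1, w ∈ LinearMap.range (symbolMap n k A ξ)) →
    ∀ J : Fin (k - n) → Fin n,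
      (∫ ξ in sphere (0 : Euc n) 1,
        (∏ i, ξ (J i)) • (Adagger n k A ξ w) ∂(μH[(n : ℝ) - 1])) = 0

section TestFun

variable [NormedAddCommGroup F] [NormedSpace ℝ F]

/-- Compactly supported smooth test function. -/
def IsTestFun (n : ℕ) (φ : Euc n → F) : Prop :=
  ContDiff ℝ (⊤ : ℕ∞) φ ∧ HasCompactSupport φ

/-- Iterated directional derivative `∂_{I 0} ⋯ ∂_{I (m-1)} φ (x)`. -/
def dirDeriv (n m : ℕ) (I : Fin m → Fin n) (φ : Euc n → F) (x : Euc n) : F :=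
  iteratedFDeriv ℝ m φ x (fun i => stdVec n (I i))

/-- Smooth functions of degree-`≤ j` polynomial type. -/
def IsPolyDeg (n : ℕ) (j : ℕ) (P : Euc n → F) : Prop :=
  ContDiff ℝ (⊤ : ℕ∞) P ∧ ∀ x, iteratedFDeriv ℝ (j + 1) P x = 0

end TestFun

/-- Pointwise application of the operator `𝒜` to a smooth map. -/
def Aapply (n k : ℕ) (A : CoeffOp n k V W) (u : Euc n → V) (x : Euc n) : W :=
  ∑ I : Fin k → Fin n, A I (dirDeriv n k I u x)

/-- `𝒜 u = f σ` (a `W`-valued measure with total-variation measure `σ` and polar density `f`)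
in the sense of distributions. -/
def HasDistribA (n k : ℕ) (A : CoeffOp n k V W) (u : Euc n → V) (σ : Measure (Euc n))
    (f : Euc n → W) : Prop :=
  ∀ φ : Euc n → W, IsTestFun n φ →
    ((-1 : ℝ) ^ k) * (∑ I : Fin k → Fin n,
        ∫ x, ⟪u x, LinearMap.adjoint (A I) (dirDeriv n k I φ x)⟫) =
      ∫ x, ⟪f x, φ x⟫ ∂σ

/-- `u ∈ BV^𝒜_loc(ℝ^n)`: `u` is locally integrable and `𝒜 u` is a `W`-valued Radon measure,
given by its polar decomposition `f σ` with `σ` locally finite and `‖f‖ = 1` σ-a.e. -/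
def MemBVAloc (n k : ℕ) (A : CoeffOp n k V W) (u : Euc n → V) : Prop :=
  LocallyIntegrable u volume ∧
    ∃ (σ : Measure (Euc n)) (f : Euc n → W), IsLocallyFiniteMeasure σ ∧
      LocallyIntegrable f σ ∧ (∀ᵐ x ∂σ, ‖f x‖ = 1) ∧ HasDistribA n k A u σ f

/-- `v` is the family of weak derivatives of order `m` of `u` (componentwise, indexed by
`I : Fin m → Fin n`). -/
def IsWeakDerivFamily (n m : ℕ) (u : Euc n → V) (v : (Fin m → Fin n) → Euc n → V) : Prop :=
  (∀ I, LocallyIntegrable (v I) volume) ∧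
    ∀ (I : Fin m → Fin n) (φ : Euc n → ℝ), IsTestFun n φ →
      ∫ x, (dirDeriv n m I φ x) • u x = ((-1 : ℝ) ^ m) • ∫ x, φ x • v I x

/-- `Q r = o(r^a)` as `r ↓ 0`. -/
def SmallO (Q : ℝ → ℝ≥0∞) (a : ℝ) : Prop :=
  Tendsto (fun r => Q r / ENNReal.ofReal (r ^ a)) (𝓝[>] (0 : ℝ)) (𝓝 0)

section Spaces

variable [NormedAddCommGroup F] [NormedSpace ℝ F]

/-- `f ∈ t^{j,p}(x)`: there is a polynomial `P` of degree at most `j` with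
`(⨍_{B_r(x)} |f - P|^p)^{1/p} = o(r^j)` as `r ↓ 0`. -/
def MemT (n : ℕ) (j : ℕ) (p : ℝ) (f : Euc n → F) (x : Euc n) : Prop :=
  ∃ P : Euc n → F, IsPolyDeg n j P ∧
    SmallO (fun r => ((volume (ball x r))⁻¹ *
      ∫⁻ y in ball x r, (‖f y - P y‖₊ : ℝ≥0∞) ^ p) ^ (1 / p)) (j : ℝ)

/-- `f ∈ t^{j,∞}(x)`: there is a polynomial `P` of degree at most `j` with
`‖f - P‖_{L^∞(B_r(x))} = o(r^j)` as `r ↓ 0`. -/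
def MemTInf (n : ℕ) (j : ℕ) (f : Euc n → F) (x : Euc n) : Prop :=
  ∃ P : Euc n → F, IsPolyDeg n j P ∧
    SmallO (fun r => essSup (fun y => (‖f y - P y‖₊ : ℝ≥0∞))
      (volume.restrict (ball x r))) (j : ℝ)

/-- The Lorentz `L^{p,q}` quasi-norm (for `p, q < ∞`). -/
def lorentzNorm {α : Type*} [MeasurableSpace α] (p q : ℝ) (μ : Measure α) (f : α → F) : ℝ≥0∞ :=
  ENNReal.ofReal p ^ (1 / q) *
    (∫⁻ t in Set.Ioi (0 : ℝ),
      (ENNReal.ofReal t * (μ {x | t < ‖f x‖}) ^ (1 / p)) ^ q * (ENNReal.ofReal t)⁻¹) ^ (1 / q)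

/-- `f` is `L^{p,q}`-differentiable of order `j` at `x`:
`‖f - P‖_{L^{p,q}(B_r(x))} = o(r^{j + n/p})` for a polynomial `P` of degree at most `j`. -/
def MemTLorentz (n : ℕ) (j : ℕ) (p q : ℝ) (f : Euc n → F) (x : Euc n) : Prop :=
  ∃ P : Euc n → F, IsPolyDeg n j P ∧
    SmallO (fun r => lorentzNorm p q (volume.restrict (ball x r)) (fun y => f y - P y))
      ((j : ℝ) + n / p)

/-- `f ∈ L^p_loc`. -/
def LocLp (n : ℕ) (p : ℝ) (f : Euc n → F) : Prop :=
  ∀ K : Set (Euc n), IsCompact K → ∫⁻ x in K, (‖f x‖₊ : ℝ≥0∞) ^ p < ⊤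

end Spaces

end

open SchwartzMap LineDeriv FourierTransform

/-- Line derivatives of Schwartz functions commute. -/
theorem SchwartzMap.lineDerivOp_comm {E F : Type*} [NormedAddCommGroup E] [NormedSpace ℝ E]
    [NormedAddCommGroup F] [NormedSpace ℝ F] (f : 𝓢(E, F)) (v w : E) :
    ∂_{v} (∂_{w} f) = ∂_{w} (∂_{v} f) := by
  ext x
  have h : IsSymmSndFDerivAt ℝ f x :=
    (f.contDiffAt 2).isSymmSndFDerivAt (by simp)
  have key : ∀ a b : E, ∂_{a} (∂_{b} f) x = fderiv ℝ (fderiv ℝ f) x a b := by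
    intro a b
    rw [lineDerivOp_apply_eq_fderiv]
    have : (⇑(∂_{b} f : 𝓢(E, F)) : E → F) = fun y => fderiv ℝ f y b := rfl
    have hd : DifferentiableAt ℝ (fderiv ℝ f) x := (fderivCLM ℝ E F f).differentiableAt
    rw [this, fderiv_clm_apply hd (by fun_prop)]
    simp
  rw [key, key, h]

theorem SchwartzMap.iteratedLineDerivOp_comm {E F : Type*} [NormedAddCommGroup E]
    [NormedSpace ℝ E] [NormedAddCommGroup F] [NormedSpace ℝ F] {a b : ℕ} (v : Fin a → E)
    (w : Fin b → E) (f : 𝓢(E, F)) : ∂^{v} (∂^{w} f) = ∂^{w} (∂^{v} f) := by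
  have one : ∀ (c : ℕ) (u : Fin c → E) (x : E) (g : 𝓢(E, F)),
      ∂_{x} (∂^{u} g) = ∂^{u} (∂_{x} g) := by
    intro c
    induction c with
    | zero => intros; rfl
    | succ c ih =>
      intro u x g
      rw [iteratedLineDerivOp_succ_left, iteratedLineDerivOp_succ_left, lineDerivOp_comm, ih]
  induction a with
  | zero => rfl
  | succ a ih => rw [iteratedLineDerivOp_succ_left, iteratedLineDerivOp_succ_left, ih, one]

theorem SchwartzMap.integral_mul_iteratedLineDerivOp {E : Type*} [NormedAddCommGroup E]
    [NormedSpace ℝ E] [FiniteDimensional ℝ E] [MeasurableSpace E] [BorelSpace E]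
    (μ : Measure E) [μ.IsAddHaarMeasure] {m : ℕ} (v : Fin m → E) (f g : 𝓢(E, ℝ)) :
    ∫ x, f x * ∂^{v} g x ∂μ = (-1) ^ m * ∫ x, ∂^{v} f x * g x ∂μ := by
  induction m generalizing f with
  | zero => simp
  | succ m ih =>
    rw [iteratedLineDerivOp_succ_left, integral_mul_lineDerivOp_right_eq_neg_left, ih,
      iteratedLineDerivOp_succ_left]
    rw [show ∂^{Fin.tail v} (∂_{v 0} f) = ∂_{v 0} (∂^{Fin.tail v} f) from
      (iteratedLineDerivOp_comm (fun _ : Fin 1 => v 0) _ f).symm]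
    ring

theorem Function.HasTemperateGrowth.prod_inner {E : Type*} [NormedAddCommGroup E]
    [InnerProductSpace ℝ E] {m : ℕ} (v : Fin m → E) :
    (fun ξ : E => ∏ i, (⟪ξ, v i⟫ : ℝ)).HasTemperateGrowth := by
  induction m with
  | zero => simp
  | succ m ih =>
    simp only [Fin.prod_univ_succ]
    exact .mul (by fun_prop) (ih _)

theorem SchwartzMap.iteratedLineDerivOp_fourierInv {E : Type*} [NormedAddCommGroup E]
    [InnerProductSpace ℝ E] [FiniteDimensional ℝ E] [MeasurableSpace E] [BorelSpace E]
    {m : ℕ} (v : Fin m → E) (g h : 𝓢(E, ℂ))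
    (hgh : ∀ ξ, h ξ = ((2 * Real.pi * Complex.I) ^ m * (∏ i, (⟪ξ, v i⟫ : ℝ) : ℝ)) * g ξ) :
    ∂^{v} (𝓕⁻ g) = 𝓕⁻ h := by
  induction m generalizing h with
  | zero =>
    rw [iteratedLineDerivOp_fin_zero]
    congr 1
    ext ξ
    simp [hgh]
  | succ m ih =>
    set h' : 𝓢(E, ℂ) := ((2 * Real.pi * Complex.I) ^ m) •
      smulLeftCLM ℂ (fun ξ : E => ∏ i : Fin m, (inner ℝ ξ (Fin.tail v i) : ℝ)) g with hh'
    have tg : (fun ξ : E => ∏ i : Fin m, (inner ℝ ξ (Fin.tail v i) : ℝ)).HasTemperateGrowth :=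
      .prod_inner (Fin.tail v)
    have tg' : (fun ξ : E => (inner ℝ ξ (v 0) : ℝ)).HasTemperateGrowth := by fun_prop
    rw [iteratedLineDerivOp_succ_left, ih (Fin.tail v) h', lineDerivOp_fourierInv_eq]
    · congr 1
      ext ξ
      rw [hgh]
      simp only [hh', smul_apply, smulLeftCLM_apply_apply tg',
        smulLeftCLM_apply_apply tg, Fin.prod_univ_succ, smul_eq_mul, Complex.real_smul]
      push_cast
      simp only [Fin.tail]
      ring
    · intro ξ
      simp only [hh', smul_apply, smulLeftCLM_apply_apply tg, smul_eq_mul,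
        Complex.real_smul]
      ring

theorem dirDeriv_schwartz {F : Type*} [NormedAddCommGroup F] [NormedSpace ℝ F] {n m : ℕ}
    (I : Fin m → Fin n) (f : 𝓢(Euc n, F)) :
    dirDeriv n m I f = ⇑(∂^{fun i => stdVec n (I i)} f) := by
  ext x
  rw [iteratedLineDerivOp_eq_iteratedFDeriv]
  rfl

section

variable {V W : Type*}
  [NormedAddCommGroup V] [InnerProductSpace ℝ V] [FiniteDimensional ℝ V]
  [NormedAddCommGroup W] [InnerProductSpace ℝ W] [FiniteDimensional ℝ W]

theorem adjoint_symbolMap (n k : ℕ) (A : CoeffOp n k V W) (ξ : Euc n) :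
    LinearMap.adjoint (symbolMap n k A ξ) =
      ∑ I : Fin k → Fin n, (∏ i, ξ (I i)) • LinearMap.adjoint (A I) := by
  simp [symbolMap, map_sum]

/-- Away from the origin, the adjoint symbol of an elliptic operator has a smooth right inverse. -/
theorem exists_smooth_rightInverse_adjoint_symbol (n k : ℕ) (A : CoeffOp n k V W)
    (hell : IsElliptic n k A) (v : V) :
    ∃ b : Euc n → W, (∀ ξ ≠ 0, ContDiffAt ℝ (⊤ : ℕ∞) b ξ) ∧
      ∀ ξ ≠ 0, ∑ I : Fin k → Fin n, (∏ i, ξ (I i)) • LinearMap.adjoint (A I) (b ξ) = v := by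
  set S : Euc n → V →L[ℝ] W := fun ξ =>
    ∑ I : Fin k → Fin n, (∏ i, ξ (I i)) • (A I).toContinuousLinearMap with hS
  set T : Euc n → W →L[ℝ] V := fun ξ =>
    ∑ I : Fin k → Fin n, (∏ i, ξ (I i)) • (LinearMap.adjoint (A I)).toContinuousLinearMap with hT
  have hSe : ∀ ξ x, S ξ x = symbolMap n k A ξ x := by
    intro ξ x; simp [hS, symbolMap]
  have hTe : ∀ ξ x, T ξ x = LinearMap.adjoint (symbolMap n k A ξ) x := by
    intro ξ x; simp [hT, adjoint_symbolMap]
  have hSs : ContDiff ℝ (⊤ : ℕ∞) S := by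
    simp only [hS]
    fun_prop
  have hTs : ContDiff ℝ (⊤ : ℕ∞) T := by
    simp only [hT]
    fun_prop
  have hM : ContDiff ℝ (⊤ : ℕ∞) (fun ξ => (T ξ).comp (S ξ)) := hTs.clm_comp hSs
  have hunit : ∀ ξ ≠ 0, IsUnit ((T ξ).comp (S ξ)) := by
    intro ξ hξ
    have hinj : LinearMap.ker ((T ξ).comp (S ξ) : V →ₗ[ℝ] V) = ⊥ := by
      rw [LinearMap.ker_eq_bot']
      intro x hx
      have h1 : LinearMap.adjoint (symbolMap n k A ξ) (symbolMap n k A ξ x) = 0 := by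
        rw [← hSe, ← hTe]; exact hx
      have h2 : ⟪symbolMap n k A ξ x, symbolMap n k A ξ x⟫ = 0 := by
        rw [← LinearMap.adjoint_inner_left, h1, inner_zero_left]
      have h3 := inner_self_eq_zero.mp h2
      exact hell ξ hξ (by rw [h3, map_zero])
    have : IsUnit (((T ξ).comp (S ξ) : V →L[ℝ] V) : V →ₗ[ℝ] V) :=
      (LinearMap.isUnit_iff_ker_eq_bot _).mpr hinj
    exact (ContinuousLinearMap.isUnit_iff_bijective).mpr
      ((Module.End.isUnit_iff _).mp this)
  refine ⟨fun ξ => S ξ (Ring.inverse ((T ξ).comp (S ξ)) v), ?_, ?_⟩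
  · intro ξ hξ
    obtain ⟨U, hU⟩ := hunit ξ hξ
    have h1 : ContDiffAt ℝ (⊤ : ℕ∞) (fun ξ => Ring.inverse ((T ξ).comp (S ξ))) ξ := by
      refine ContDiffAt.comp (g := Ring.inverse (M₀ := V →L[ℝ] V)) ξ ?_ hM.contDiffAt
      rw [← hU]
      exact contDiffAt_ringInverse ℝ U
    exact hSs.contDiffAt.clm_apply (h1.clm_apply contDiffAt_const)
  · intro ξ hξ
    have h := Ring.mul_inverse_cancel _ (hunit ξ hξ)
    have h' := congrArg (fun f : V →L[ℝ] V => f v) h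
    calc _ = T ξ (S ξ (Ring.inverse ((T ξ).comp (S ξ)) v)) := by simp [hT]
      _ = v := h'

theorem SchwartzMap.iteratedLineDerivOp_postcompCLM {E F G : Type*} [NormedAddCommGroup E]
    [NormedSpace ℝ E] [NormedAddCommGroup F] [NormedSpace ℝ F] [NormedAddCommGroup G]
    [NormedSpace ℝ G] {m : ℕ} (v : Fin m → E) (L : F →L[ℝ] G) (f : 𝓢(E, F)) :
    ∂^{v} (f.postcompCLM L) = (∂^{v} f).postcompCLM L := by
  ext x
  rw [postcompCLM_apply, iteratedLineDerivOp_eq_iteratedFDeriv,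
    iteratedLineDerivOp_eq_iteratedFDeriv]
  have : (⇑(f.postcompCLM L) : E → G) = L ∘ f := by ext y; simp
  rw [this, L.iteratedFDeriv_comp_left (f.contDiffAt m) le_rfl]
  rfl

/-- The real part of the inverse Fourier transform of a real Schwartz function. -/
noncomputable def reFourierInv {E : Type*} [NormedAddCommGroup E]
    [InnerProductSpace ℝ E] [FiniteDimensional ℝ E] [MeasurableSpace E] [BorelSpace E]
    : 𝓢(E, ℝ) →ₗ[ℝ] 𝓢(E, ℝ) where
  toFun g := (𝓕⁻ (g.postcompCLM Complex.ofRealCLM) : 𝓢(E, ℂ)).postcompCLM Complex.reCLM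
  map_add' g h := by rw [map_add, FourierTransform.fourierInv_add, map_add]
  map_smul' c g := by
    rw [map_smul, FourierTransform.fourierInv_smul, map_smul, RingHom.id_apply]

theorem exists_iteratedLineDerivOp_eq_reFourierInv {E : Type*} [NormedAddCommGroup E]
    [InnerProductSpace ℝ E] [FiniteDimensional ℝ E] [MeasurableSpace E] [BorelSpace E]
    (k : ℕ) (g : 𝓢(E, ℝ)) :
    ∃ G : 𝓢(E, ℝ), ∀ v : Fin k → E,
      ∂^{v} G = reFourierInv (smulLeftCLM ℝ (fun ξ => ∏ i, (⟪ξ, v i⟫ : ℝ)) g) := by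
  refine ⟨(𝓕⁻ ((((2 * Real.pi * Complex.I) ^ k)⁻¹ : ℂ) • g.postcompCLM Complex.ofRealCLM)
    : 𝓢(E, ℂ)).postcompCLM Complex.reCLM, fun v => ?_⟩
  rw [iteratedLineDerivOp_postcompCLM, reFourierInv, LinearMap.coe_mk, AddHom.coe_mk]
  congr 1
  apply iteratedLineDerivOp_fourierInv
  intro ξ
  have hne : ((2 * Real.pi * Complex.I) ^ k : ℂ) ≠ 0 := by
    simp [Real.pi_ne_zero]
  simp only [postcompCLM_apply, smulLeftCLM_apply_apply (.prod_inner v), smul_apply,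
    Complex.ofRealCLM_apply, smul_eq_mul]
  field_simp
  push_cast
  ring

theorem reFourierInv_apply {E : Type*} [NormedAddCommGroup E]
    [InnerProductSpace ℝ E] [FiniteDimensional ℝ E] [MeasurableSpace E] [BorelSpace E]
    (g : 𝓢(E, ℝ)) (x : E) :
    reFourierInv g x = ∫ ξ, Real.cos (2 * Real.pi * ⟪ξ, x⟫) * g ξ := by
  have h : Integrable (fun ξ => Complex.exp (((2 * Real.pi * ⟪ξ, x⟫ : ℝ) : ℂ) * Complex.I) •
      (g ξ : ℂ)) := by
    refine (g.integrable (μ := volume)).ofReal.bdd_mul (c := 1) ?_ ?_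
    · fun_prop
    · filter_upwards with ξ
      rw [Complex.norm_exp_ofReal_mul_I]
  simp only [reFourierInv, LinearMap.coe_mk, AddHom.coe_mk, postcompCLM_apply,
    fourierInv_coe, Real.fourierInv_eq']
  simp only [Complex.ofRealCLM_apply]
  rw [← ContinuousLinearMap.integral_comp_comm _ h]
  congr 1
  ext ξ
  simp only [Complex.reCLM_apply, smul_eq_mul, Complex.re_mul_ofReal,
    Complex.exp_ofReal_mul_I_re]

end

section

variable {V W : Type*}
  [NormedAddCommGroup V] [InnerProductSpace ℝ V] [FiniteDimensional ℝ V]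
  [NormedAddCommGroup W] [InnerProductSpace ℝ W] [FiniteDimensional ℝ W]

theorem integral_reFourierInv {E : Type*} [NormedAddCommGroup E]
    [InnerProductSpace ℝ E] [FiniteDimensional ℝ E] [MeasurableSpace E] [BorelSpace E]
    (g : 𝓢(E, ℝ)) : ∫ x, reFourierInv g x = g 0 := by
  set G : 𝓢(E, ℂ) := g.postcompCLM Complex.ofRealCLM with hG
  have h1 : 𝓕 (𝓕⁻ G) 0 = G 0 := by rw [FourierTransform.fourier_fourierInv_eq]
  rw [fourier_coe, Real.fourier_eq'] at h1
  simp only [inner_zero_right, mul_zero, Complex.ofReal_zero, zero_mul, Complex.exp_zero,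
    one_smul] at h1
  simp only [reFourierInv, LinearMap.coe_mk, AddHom.coe_mk, postcompCLM_apply]
  rw [ContinuousLinearMap.integral_comp_comm _ (SchwartzMap.integrable _), ← hG, h1]
  simp [hG]

theorem reFourierInv_dilation {n : ℕ} (g h : 𝓢(Euc n, ℝ))
    (hgh : ∀ ξ, h ξ = g ((2 : ℝ)⁻¹ • ξ)) (x : Euc n) :
    reFourierInv h x = 2 ^ n * reFourierInv g ((2 : ℝ) • x) := by
  rw [reFourierInv_apply, reFourierInv_apply]
  have := Measure.integral_comp_inv_smul_of_nonneg (volume : Measure (Euc n))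
    (fun ξ => Real.cos (2 * Real.pi * ⟪ξ, (2 : ℝ) • x⟫) * g ξ) (R := 2) (by norm_num)
  simp only [finrank_euclideanSpace, Fintype.card_fin, smul_eq_mul] at this
  rw [← this]
  congr 1
  ext ξ
  rw [hgh]
  simp [inner_smul_left, inner_smul_right]

theorem inner_stdVec {n : ℕ} (ξ : Euc n) (i : Fin n) : ⟪ξ, stdVec n i⟫ = ξ i := by
  simp [stdVec, EuclideanSpace.inner_single_right]

/-- Dyadic building block of a parametrix for the adjoint of an elliptic operator. -/
theorem exists_dyadic_parametrix (n k : ℕ) (A : CoeffOp n k V W) (hell : IsElliptic n k A) :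
    ∃ ρ : 𝓢(Euc n, ℝ), ∫ x, ρ x = 1 ∧ ∀ v : V, ∃ K : 𝓢(Euc n, W), ∀ x,
      ∑ I : Fin k → Fin n, LinearMap.adjoint (A I) (∂^{fun i => stdVec n (I i)} K x) =
        (2 ^ n * ρ ((2 : ℝ) • x) - ρ x) • v := by
  let χ : ContDiffBump (0 : Euc n) := ⟨1, 2, by norm_num, by norm_num⟩
  have hχc : HasCompactSupport (χ : Euc n → ℝ) := χ.hasCompactSupport
  have hχs : ContDiff ℝ (⊤ : ℕ∞) (χ : Euc n → ℝ) := χ.contDiff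
  have hχ2c : HasCompactSupport (fun ξ : Euc n => χ ((2 : ℝ)⁻¹ • ξ)) :=
    hχc.comp_smul (by norm_num)
  have hχ2s : ContDiff ℝ (⊤ : ℕ∞) (fun ξ : Euc n => χ ((2 : ℝ)⁻¹ • ξ)) :=
    hχs.comp (by fun_prop)
  set X : 𝓢(Euc n, ℝ) := hχc.toSchwartzMap hχs with hX
  set X2 : 𝓢(Euc n, ℝ) := hχ2c.toSchwartzMap hχ2s with hX2
  have hXa : ∀ ξ, X ξ = χ ξ := fun _ => rfl
  have hX2a : ∀ ξ, X2 ξ = χ ((2 : ℝ)⁻¹ • ξ) := fun _ => rfl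
  refine ⟨reFourierInv X, ?_, fun v => ?_⟩
  · rw [integral_reFourierInv, hXa]
    exact χ.one_of_mem_closedBall (by simp [χ])
  set ψ : 𝓢(Euc n, ℝ) := X2 - X with hψ
  have hψ0 : (ψ : Euc n → ℝ) =ᶠ[𝓝 0] 0 := by
    filter_upwards [closedBall_mem_nhds (0 : Euc n) (show (0 : ℝ) < 1 by norm_num)] with ξ hξ
    have h1 : χ ξ = 1 := χ.one_of_mem_closedBall hξ
    have h2 : χ ((2 : ℝ)⁻¹ • ξ) = 1 := by
      apply χ.one_of_mem_closedBall
      simp only [mem_closedBall, dist_zero_right, norm_smul] at hξ ⊢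
      norm_num [χ]
      linarith
    simp [hψ, hXa, hX2a, h1, h2]
  have hψc : HasCompactSupport (ψ : Euc n → ℝ) := hχ2c.sub hχc
  obtain ⟨b, hbs, hb⟩ := exists_smooth_rightInverse_adjoint_symbol n k A hell v
  let w := stdOrthonormalBasis ℝ W
  have hgc : ∀ a, HasCompactSupport (fun ξ => ψ ξ * ⟪w a, b ξ⟫) := fun a => hψc.mul_right
  have hgs : ∀ a, ContDiff ℝ (⊤ : ℕ∞) (fun ξ => ψ ξ * ⟪w a, b ξ⟫) := by
    intro a
    rw [contDiff_iff_contDiffAt]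
    intro ξ
    by_cases hξ : ξ = 0
    · subst hξ
      refine (contDiffAt_const (c := (0 : ℝ))).congr_of_eventuallyEq ?_
      filter_upwards [hψ0] with ξ hξ
      simp [hξ]
    · exact (ψ.contDiffAt ⊤).mul (contDiffAt_const.inner ℝ (hbs ξ hξ))
  let g : Fin (Module.finrank ℝ W) → 𝓢(Euc n, ℝ) := fun a => (hgc a).toSchwartzMap (hgs a)
  have hga : ∀ a ξ, g a ξ = ψ ξ * ⟪w a, b ξ⟫ := fun _ _ => rfl
  choose K hK using fun a => exists_iteratedLineDerivOp_eq_reFourierInv k (g a)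
  refine ⟨∑ a, (K a).postcompCLM ((ContinuousLinearMap.id ℝ ℝ).smulRight (w a)), fun x => ?_⟩
  simp only [iteratedLineDerivOp_sum, _root_.sum_apply, iteratedLineDerivOp_postcompCLM,
    postcompCLM_apply, hK, inner_stdVec]
  refine ext_inner_left ℝ fun y => ?_
  have key : ∑ I : Fin k → Fin n, ∑ a, ⟪y, LinearMap.adjoint (A I) (w a)⟫ •
      smulLeftCLM ℝ (fun ξ : Euc n => ∏ i, ξ (I i)) (g a) = ⟪y, v⟫ • ψ := by
    ext ξ
    have ht : ∀ I : Fin k → Fin n, (fun ξ : Euc n => ∏ i, ξ (I i)).HasTemperateGrowth := by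
      intro I
      simpa only [inner_stdVec] using
        Function.HasTemperateGrowth.prod_inner (fun i => stdVec n (I i))
    simp only [_root_.sum_apply, smul_apply, smulLeftCLM_apply_apply (ht _), hga, smul_eq_mul]
    by_cases hξ : ξ = 0
    · have : ψ 0 = 0 := hψ0.self_of_nhds
      simp [hξ, this]
    · conv_rhs => rw [← hb ξ hξ, inner_sum, Finset.sum_mul]
      refine Finset.sum_congr rfl fun I _ => ?_
      conv_rhs => rw [← w.sum_repr' (b ξ)]
      simp only [map_sum, map_smul, inner_sum, Finset.smul_sum, inner_smul_right, Finset.sum_mul]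
      refine Finset.sum_congr rfl fun a _ => ?_
      ring
  have key2 := congrArg (fun f : 𝓢(Euc n, ℝ) => f x) (congrArg reFourierInv key)
  simp only [map_sum, map_smul, _root_.sum_apply, smul_apply, smul_eq_mul] at key2
  have h2 : reFourierInv X2 x = 2 ^ n * reFourierInv X ((2 : ℝ) • x) :=
    reFourierInv_dilation X X2 (fun ξ => rfl) x
  rw [hψ, map_sub, _root_.sub_apply, h2] at key2
  rw [inner_smul_right, mul_comm, ← key2]
  simp only [map_sum, inner_sum, ContinuousLinearMap.smulRight_apply,
    ContinuousLinearMap.id_apply, map_smul, inner_smul_right]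
  refine Finset.sum_congr rfl fun I _ => Finset.sum_congr rfl fun a _ => mul_comm _ _

end

/-- The Riesz kernel `‖x‖ ^ (-s)` truncated to the ball of radius `R`. -/
noncomputable def truncRiesz (n : ℕ) (s R : ℝ) (x : Euc n) : ℝ≥0∞ :=
  (ball (0 : Euc n) R).indicator (fun x => ‖x‖ₑ ^ (-s)) x

theorem measurable_truncRiesz (n : ℕ) (s R : ℝ) : Measurable (truncRiesz n s R) :=
  (measurable_enorm.pow_const _).indicator measurableSet_ball

theorem lintegral_truncRiesz_rpow_lt_top {n : ℕ} (hn : 1 ≤ n) {s R p : ℝ} (hp : 0 < p)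
    (hps : p * s < n) : ∫⁻ x, truncRiesz n s R x ^ p < ⊤ := by
  have : Nontrivial (Euc n) := by
    apply Module.nontrivial_of_finrank_pos (R := ℝ)
    simp; omega
  have hloc : LocallyIntegrable (fun x : Euc n => ‖x‖ ^ (-(p * s))) volume := by
    refine locallyIntegrable_of_norm_le_rpow (C := 1) (by simpa) (α := p * s) (by simpa) ?_ ?_
    · filter_upwards with x
      rw [Real.norm_of_nonneg (by positivity), one_mul]
    · exact (measurable_norm.pow_const _).aestronglyMeasurable
  have hint : IntegrableOn (fun x : Euc n => ‖x‖ ^ (-(p * s))) (ball 0 R) volume :=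
    (hloc.integrableOn_isCompact (isCompact_closedBall 0 R)).mono_set ball_subset_closedBall
  have hfin := hint.lintegral_lt_top
  refine lt_of_le_of_lt (le_of_eq ?_) hfin
  rw [← lintegral_indicator measurableSet_ball]
  refine lintegral_congr_ae ?_
  filter_upwards [compl_mem_ae_iff.mpr (measure_singleton (0 : Euc n))] with x hx
  have hx0 : 0 < ‖x‖ := norm_pos_iff.mpr hx
  by_cases hxb : x ∈ ball (0 : Euc n) R
  · simp only [truncRiesz, Set.indicator_of_mem hxb]
    rw [← ofReal_norm, ENNReal.ofReal_rpow_of_pos hx0,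
      ENNReal.ofReal_rpow_of_pos (by positivity), ← Real.rpow_mul hx0.le]
    congr 2; ring
  · simp only [truncRiesz, Set.indicator_of_notMem hxb, ENNReal.zero_rpow_of_pos hp]

/-- Truncated Riesz potential of a measure. -/
noncomputable def rieszPot (n : ℕ) (s R : ℝ) (τ : Measure (Euc n)) (x : Euc n) : ℝ≥0∞ :=
  ∫⁻ y, truncRiesz n s R (x - y) ∂τ

theorem measurable_rieszPot (n : ℕ) (s R : ℝ) (τ : Measure (Euc n)) [SFinite τ] :
    Measurable (rieszPot n s R τ) :=
  Measurable.lintegral_prod_right' (f := fun z : Euc n × Euc n => truncRiesz n s R (z.1 - z.2))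
    ((measurable_truncRiesz n s R).comp measurable_sub)

theorem lintegral_rpow_le_measure_univ_mul {X : Type*} [MeasurableSpace X] (μ : Measure X)
    {f : X → ℝ≥0∞} (hf : Measurable f) {p : ℝ} (hp : 1 ≤ p) :
    (∫⁻ x, f x ∂μ) ^ p ≤ μ Set.univ ^ (p - 1) * ∫⁻ x, f x ^ p ∂μ := by
  have h := eLpNorm'_le_eLpNorm'_mul_rpow_measure_univ one_pos hp
    (hf.aestronglyMeasurable (μ := μ))
  have h' := ENNReal.rpow_le_rpow h (by linarith : (0 : ℝ) ≤ p)
  simp only [eLpNorm', enorm_eq_self, ENNReal.rpow_one, div_one] at h'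
  rw [ENNReal.mul_rpow_of_nonneg _ _ (by linarith), ← ENNReal.rpow_mul, ← ENNReal.rpow_mul,
    one_div_mul_cancel (by linarith), ENNReal.rpow_one, mul_comm] at h'
  convert h' using 3
  field_simp

theorem lintegral_rieszPot_rpow_lt_top {n : ℕ} (hn : 1 ≤ n) {s R p : ℝ} (hp : 1 ≤ p)
    (hps : p * s < n) (τ : Measure (Euc n)) [IsLocallyFiniteMeasure τ] {K : Set (Euc n)}
    (hK : IsCompact K) : ∫⁻ x in K, rieszPot n s R τ x ^ p < ⊤ := by
  obtain ⟨r, hr⟩ := hK.isBounded.subset_closedBall 0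
  set τ' := τ.restrict (closedBall 0 (r + R)) with hτ'
  have : IsFiniteMeasure τ' :=
    ⟨by simpa [hτ'] using (isCompact_closedBall (0 : Euc n) (r + R)).measure_lt_top⟩
  have hmeas : Measurable fun z : Euc n × Euc n => truncRiesz n s R (z.1 - z.2) :=
    (measurable_truncRiesz n s R).comp measurable_sub
  have h1 : ∀ x ∈ K, rieszPot n s R τ x ^ p ≤
      τ' Set.univ ^ (p - 1) * ∫⁻ y, truncRiesz n s R (x - y) ^ p ∂τ' := by
    intro x hx
    refine le_trans (le_of_eq ?_) (lintegral_rpow_le_measure_univ_mul τ'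
      (hmeas.comp measurable_prodMk_left) hp)
    congr 1
    rw [hτ', ← lintegral_indicator measurableSet_closedBall]
    refine lintegral_congr fun y => ?_
    by_cases hy : y ∈ closedBall (0 : Euc n) (r + R)
    · simp [Set.indicator_of_mem hy]
    · rw [Set.indicator_of_notMem hy, truncRiesz, Set.indicator_of_notMem]
      intro hxy
      apply hy
      have hx' := hr hx
      simp only [mem_closedBall, mem_ball, dist_zero_right] at hx' hxy ⊢
      have := norm_sub_norm_le y x
      rw [norm_sub_rev] at this
      linarith
  calc ∫⁻ x in K, rieszPot n s R τ x ^ p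
      ≤ ∫⁻ x in K, τ' Set.univ ^ (p - 1) * ∫⁻ y, truncRiesz n s R (x - y) ^ p ∂τ' :=
        setLIntegral_mono' hK.measurableSet h1
    _ ≤ ∫⁻ x, τ' Set.univ ^ (p - 1) * ∫⁻ y, truncRiesz n s R (x - y) ^ p ∂τ' :=
        setLIntegral_le_lintegral _ _
    _ = τ' Set.univ ^ (p - 1) * ∫⁻ y, (∫⁻ x, truncRiesz n s R (x - y) ^ p) ∂τ' := by
        rw [lintegral_const_mul' _ _ (by finiteness), lintegral_lintegral_swap]
        exact (hmeas.pow_const p).aemeasurable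
    _ = τ' Set.univ ^ (p - 1) * (τ' Set.univ * ∫⁻ x, truncRiesz n s R x ^ p) := by
        simp_rw [lintegral_sub_right_eq_self (fun x => truncRiesz n s R x ^ p)]
        rw [lintegral_const, mul_comm (τ' _)]
    _ < ⊤ := by
        have := lintegral_truncRiesz_rpow_lt_top hn (R := R) (by linarith : 0 < p) hps
        have h2 : τ' Set.univ ^ (p - 1) ≠ ⊤ :=
          ENNReal.rpow_ne_top_of_nonneg (by linarith) (measure_ne_top _ _)
        finiteness

section

variable {F G : Type*} [NormedAddCommGroup F] [NormedSpace ℝ F]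
  [NormedAddCommGroup G] [NormedSpace ℝ G]

theorem SchwartzMap.exists_norm_rpow_mul_iteratedFDeriv_le {E : Type*} [NormedAddCommGroup E]
    [NormedSpace ℝ E] (f : 𝓢(E, F)) (l : ℕ) {r : ℝ} (hr : 0 ≤ r) :
    ∃ M : ℝ, 0 ≤ M ∧ ∀ x, ‖x‖ ^ r * ‖iteratedFDeriv ℝ l f x‖ ≤ M := by
  obtain ⟨M0, h0, hM0⟩ := f.decay 0 l
  obtain ⟨M1, h1, hM1⟩ := f.decay ⌈r⌉₊ l
  refine ⟨M0 + M1, by positivity, fun x => ?_⟩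
  have hx : ‖x‖ ^ r ≤ ‖x‖ ^ 0 + ‖x‖ ^ ⌈r⌉₊ := by
    rcases le_total ‖x‖ 1 with h | h
    · have := Real.rpow_le_one (norm_nonneg x) h hr
      have := pow_nonneg (norm_nonneg x) ⌈r⌉₊
      rw [pow_zero]; linarith
    · have := Real.rpow_le_rpow_of_exponent_le h (Nat.le_ceil r)
      rw [Real.rpow_natCast] at this
      rw [pow_zero]; linarith
  calc _ ≤ (‖x‖ ^ 0 + ‖x‖ ^ ⌈r⌉₊) * ‖iteratedFDeriv ℝ l f x‖ := by gcongr
    _ ≤ _ := by rw [add_mul]; exact add_le_add (hM0 x) (hM1 x)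

/-- The dilate `x ↦ f (t • x)` of a Schwartz function, cut off by a smooth bump. -/
noncomputable def cutScale {n : ℕ} (ζ : ContDiffBump (0 : Euc n)) (f : 𝓢(Euc n, F)) (t : ℝ) :
    𝓢(Euc n, F) :=
  (ζ.hasCompactSupport.smul_right (f' := fun x => f (t • x))).toSchwartzMap
    (ζ.contDiff.smul ((f.smooth ⊤).comp (contDiff_const_smul t)))

theorem cutScale_apply {n : ℕ} (ζ : ContDiffBump (0 : Euc n)) (f : 𝓢(Euc n, F)) (t : ℝ)
    (x : Euc n) : cutScale ζ f t x = ζ x • f (t • x) := rfl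

theorem support_cutScale_subset {n : ℕ} (ζ : ContDiffBump (0 : Euc n)) (f : 𝓢(Euc n, F)) (t : ℝ) :
    Function.support (cutScale ζ f t) ⊆ ball 0 ζ.rOut := by
  intro x hx
  rw [← ζ.support_eq]
  exact fun h => hx (by rw [cutScale_apply, h, zero_smul])

theorem hasCompactSupport_cutScale {n : ℕ} (ζ : ContDiffBump (0 : Euc n)) (f : 𝓢(Euc n, F))
    (t : ℝ) : HasCompactSupport (cutScale ζ f t) :=
  ζ.hasCompactSupport.smul_right

theorem SchwartzMap.hasCompactSupport_iteratedLineDerivOp {E : Type*} [NormedAddCommGroup E]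
    [NormedSpace ℝ E] {m : ℕ} (v : Fin m → E) {f : 𝓢(E, F)} (hf : HasCompactSupport f) :
    HasCompactSupport (∂^{v} f : 𝓢(E, F)) :=
  hf.of_isClosed_subset (isClosed_tsupport _) (tsupport_iteratedLineDerivOp_subset v f)

theorem SchwartzMap.norm_iteratedLineDerivOp_stdVec_le {n m : ℕ} (α : Fin m → Fin n)
    (f : 𝓢(Euc n, F)) (x : Euc n) :
    ‖∂^{fun i => stdVec n (α i)} f x‖ ≤ ‖iteratedFDeriv ℝ m f x‖ := by
  rw [iteratedLineDerivOp_eq_iteratedFDeriv]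
  refine (ContinuousMultilinearMap.le_opNorm _ _).trans (le_of_eq ?_)
  simp [stdVec]

theorem exists_norm_iteratedFDeriv_cutScale_le {n : ℕ} (ζ : ContDiffBump (0 : Euc n))
    (f : 𝓢(Euc n, F)) (i : ℕ) {r : ℝ} (hr : 0 ≤ r) :
    ∃ C : ℝ, 0 < C ∧ ∀ t : ℝ, 1 ≤ t → ∀ x ≠ 0,
      ‖iteratedFDeriv ℝ i (cutScale ζ f t) x‖ ≤ C * t ^ ((i : ℝ) - r) * ‖x‖ ^ (-r) := by
  choose M hM0 hM using fun l => f.exists_norm_rpow_mul_iteratedFDeriv_le l hr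
  let Z : 𝓢(Euc n, ℝ) := ζ.hasCompactSupport.toSchwartzMap ζ.contDiff
  choose B hB0 hB using fun l => Z.decay 0 l
  refine ⟨(∑ j ∈ Finset.range (i + 1), (i.choose j : ℝ) * B j * M (i - j)) + 1,
    add_pos_of_nonneg_of_pos (Finset.sum_nonneg fun j _ => ?_) one_pos, fun t ht x hx => ?_⟩
  · have := (hB0 j).le; have := hM0 (i - j); positivity
  have ht0 : 0 < t := by linarith
  have hx0 : 0 < ‖x‖ := norm_pos_iff.mpr hx
  have h1 := norm_iteratedFDeriv_smul_le (𝕜 := ℝ) (f := fun y => Z y) (g := fun y => f (t • y))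
    (Z.smooth ⊤) ((f.smooth ⊤).comp (contDiff_const_smul t)) x (n := i) (by exact_mod_cast le_top)
  have h2 : ∀ j ∈ Finset.range (i + 1), (i.choose j : ℝ) * ‖iteratedFDeriv ℝ j (fun y => Z y) x‖ *
      ‖iteratedFDeriv ℝ (i - j) (fun y => f (t • y)) x‖ ≤
      ((i.choose j : ℝ) * B j * M (i - j)) * (t ^ ((i : ℝ) - r) * ‖x‖ ^ (-r)) := by
    intro j hj
    have hb := hB j x
    rw [pow_zero, one_mul] at hb
    have hm := hM (i - j) (t • x)
    rw [iteratedFDeriv_comp_const_smul _ (by exact_mod_cast f.smooth ((i - j : ℕ) : ℕ∞)), norm_smul,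
      norm_pow, Real.norm_of_nonneg ht0.le]
    rw [norm_smul, Real.norm_of_nonneg ht0.le, Real.mul_rpow ht0.le hx0.le] at hm
    have hpow : t ^ (i - j) ≤ t ^ (i : ℝ) := by
      rw [Real.rpow_natCast]; exact pow_le_pow_right₀ ht (Nat.sub_le _ _)
    have h3 : ‖iteratedFDeriv ℝ (i - j) f (t • x)‖ ≤ M (i - j) * (t ^ (-r) * ‖x‖ ^ (-r)) := by
      rw [Real.rpow_neg ht0.le, Real.rpow_neg hx0.le, ← mul_inv, ← div_eq_mul_inv,
        le_div_iff₀ (by positivity)]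
      linarith
    have hM' := hM0 (i - j)
    have hB' := (hB0 j).le
    calc _ ≤ (i.choose j : ℝ) * B j * (t ^ (i : ℝ) * (M (i - j) * (t ^ (-r) * ‖x‖ ^ (-r)))) := by
          gcongr
      _ = _ := by rw [sub_eq_add_neg, Real.rpow_add ht0]; ring
  calc ‖iteratedFDeriv ℝ i (cutScale ζ f t) x‖ ≤ _ := h1
    _ ≤ _ := Finset.sum_le_sum h2
    _ ≤ _ := by
      rw [← Finset.sum_mul, mul_assoc]
      gcongr
      linarith

theorem exists_enorm_iteratedLineDerivOp_cutScale_le {n : ℕ} (ζ : ContDiffBump (0 : Euc n))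
    (f : 𝓢(Euc n, F)) {i : ℕ} (α : Fin i → Fin n) {r : ℝ} (hr : 0 < r) :
    ∃ C : ℝ, 0 < C ∧ ∀ t : ℝ, 1 ≤ t → ∀ x,
      ‖∂^{fun l => stdVec n (α l)} (cutScale ζ f t) x‖ₑ ≤
        ENNReal.ofReal (C * t ^ ((i : ℝ) - r)) * truncRiesz n r (ζ.rOut + 1) x := by
  obtain ⟨C, hC, h⟩ := exists_norm_iteratedFDeriv_cutScale_le ζ f i hr.le
  refine ⟨C, hC, fun t ht x => ?_⟩
  by_cases hxb : x ∈ ball (0 : Euc n) (ζ.rOut + 1)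
  · rw [truncRiesz, Set.indicator_of_mem hxb]
    by_cases hx : x = 0
    · subst hx
      have : ENNReal.ofReal (C * t ^ ((i : ℝ) - r)) ≠ 0 := by
        rw [ne_eq, ENNReal.ofReal_eq_zero, not_le]
        positivity
      rw [enorm_zero, ENNReal.zero_rpow_of_neg (by linarith), ENNReal.mul_top this]
      exact le_top
    · have hx0 : 0 < ‖x‖ := norm_pos_iff.mpr hx
      rw [← ofReal_norm, ← ofReal_norm, ENNReal.ofReal_rpow_of_pos hx0,
        ← ENNReal.ofReal_mul (by positivity)]
      exact ENNReal.ofReal_le_ofReal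
        ((norm_iteratedLineDerivOp_stdVec_le α _ x).trans (h t ht x hx))
  · have : ∂^{fun l => stdVec n (α l)} (cutScale ζ f t) x = 0 := by
      refine image_eq_zero_of_notMem_tsupport fun hx => hxb ?_
      have h1 := tsupport_iteratedLineDerivOp_subset _ _ hx
      have h2 : tsupport (cutScale ζ f t) ⊆ closedBall 0 ζ.rOut :=
        closure_minimal ((support_cutScale_subset ζ f t).trans ball_subset_closedBall)
          isClosed_closedBall
      exact closedBall_subset_ball (by linarith) (h2 h1)
    rw [this, enorm_zero]
    exact zero_le

theorem SchwartzMap.exists_iteratedLineDerivOp_comp_eq {E ι : Type*} [NormedAddCommGroup E]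
    [NormedSpace ℝ E] (e : ι → E) {a b : ℕ} (α : Fin a → ι) (β : Fin b → ι) :
    ∃ γ : Fin (a + b) → ι, ∀ f : 𝓢(E, F),
      ∂^{fun i => e (α i)} (∂^{fun i => e (β i)} f) = ∂^{fun i => e (γ i)} f := by
  suffices h : ∃ M, ∃ _ : M = a + b, ∃ γ : Fin M → ι, ∀ f : 𝓢(E, F),
      ∂^{fun i => e (α i)} (∂^{fun i => e (β i)} f) = ∂^{fun i => e (γ i)} f by
    obtain ⟨M, rfl, γ, h⟩ := h
    exact ⟨γ, h⟩
  induction a with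
  | zero => exact ⟨b, by omega, β, fun f => rfl⟩
  | succ a ih =>
    obtain ⟨M, hM, γ, h⟩ := ih (Fin.tail α)
    refine ⟨M + 1, by omega, Fin.cons (α 0) γ, fun f => ?_⟩
    rw [iteratedLineDerivOp_succ_left, iteratedLineDerivOp_succ_left]
    simp only [Fin.cons_zero]
    have h1 := h f
    congr 1

end

section

variable {V W F F' : Type*} [NormedAddCommGroup F]

/-- Geometric decay of a sequence of kernels relative to a truncated Riesz kernel. -/
def DyadicDecay {n : ℕ} (q s R : ℝ) (g : ℕ → Euc n → F) : Prop :=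
  ∃ C : ℝ, 0 ≤ C ∧ ∀ N x, ‖g N x‖ₑ ≤ ENNReal.ofReal (C * q ^ N) * truncRiesz n s R x

theorem DyadicDecay.sum {n : ℕ} {q s R : ℝ} (hq : 0 ≤ q) {ι : Type*} (S : Finset ι)
    {g : ι → ℕ → Euc n → F} (h : ∀ i ∈ S, DyadicDecay q s R (g i)) :
    DyadicDecay q s R (fun N x => ∑ i ∈ S, g i N x) := by
  choose! C hC h using h
  refine ⟨∑ i ∈ S, C i, Finset.sum_nonneg hC, fun N x => (enorm_sum_le _ _).trans ?_⟩
  refine (Finset.sum_le_sum fun i hi => h i hi N x).trans (le_of_eq ?_)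
  rw [← Finset.sum_mul, ← ENNReal.ofReal_sum_of_nonneg
    (fun i hi => mul_nonneg (hC i hi) (pow_nonneg hq N)), Finset.sum_mul]

theorem DyadicDecay.sub {n : ℕ} {q s R : ℝ} (hq : 0 ≤ q) {g h : ℕ → Euc n → F}
    (hg : DyadicDecay q s R g) (hh : DyadicDecay q s R h) :
    DyadicDecay q s R (fun N x => g N x - h N x) := by
  obtain ⟨C, hC, h1⟩ := hg
  obtain ⟨D, hD, h2⟩ := hh
  refine ⟨C + D, by positivity, fun N x => enorm_sub_le.trans ?_⟩
  rw [add_mul, ENNReal.ofReal_add (by positivity) (by positivity), add_mul]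
  exact add_le_add (h1 N x) (h2 N x)

theorem DyadicDecay.mono {n : ℕ} {q q' s R : ℝ} {g : ℕ → Euc n → F}
    (hg : DyadicDecay q s R g) (hq : 0 ≤ q) (hqq : q ≤ q') : DyadicDecay q' s R g := by
  obtain ⟨C, hC, h⟩ := hg
  refine ⟨C, hC, fun N x => (h N x).trans ?_⟩
  gcongr

variable [NormedSpace ℝ F] [NormedAddCommGroup F'] [NormedSpace ℝ F']

theorem DyadicDecay.clm_comp {n : ℕ} {q s R : ℝ} {g : ℕ → Euc n → F}
    (hg : DyadicDecay q s R g) (L : F →L[ℝ] F') :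
    DyadicDecay q s R (fun N x => L (g N x)) := by
  obtain ⟨C, hC, h⟩ := hg
  refine ⟨‖L‖ * C, by positivity, fun N x => ?_⟩
  rw [mul_assoc, ENNReal.ofReal_mul (norm_nonneg _), ofReal_norm, mul_assoc]
  exact (L.le_opENorm _).trans (by gcongr; exact h N x)

theorem dyadicDecay_cutScale {n : ℕ} (ζ : ContDiffBump (0 : Euc n)) (f : 𝓢(Euc n, F)) {i : ℕ}
    (α : Fin i → Fin n) {r : ℝ} (hr : 0 < r) (a : ℝ) (N₀ : ℕ) :
    DyadicDecay (2 ^ (a + i - r)) r (ζ.rOut + 1) (fun N x => ∂^{fun l => stdVec n (α l)}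
      ((((2 : ℝ) ^ (N + N₀)) ^ a) • cutScale ζ f (2 ^ (N + N₀))) x) := by
  obtain ⟨C, hC, h⟩ := exists_enorm_iteratedLineDerivOp_cutScale_le ζ f α hr
  refine ⟨C * (2 ^ (a + i - r)) ^ N₀, by positivity, fun N x => ?_⟩
  have ht : (1 : ℝ) ≤ 2 ^ (N + N₀) := one_le_pow₀ (by norm_num)
  have ht0 : (0 : ℝ) < 2 ^ (N + N₀) := by positivity
  beta_reduce
  rw [iteratedLineDerivOp_smul, smul_apply, enorm_smul, Real.enorm_of_nonneg (by positivity)]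
  calc _ ≤ _ := mul_le_mul_right (h _ ht x) _
    _ = _ := by
      rw [← mul_assoc, ← ENNReal.ofReal_mul (by positivity)]
      congr 2
      rw [mul_assoc, ← pow_add, add_comm N₀ N, ← Real.rpow_natCast (2 ^ (a + i - r)),
        ← Real.rpow_mul (by norm_num), mul_comm _ ((N + N₀ : ℕ) : ℝ), Real.rpow_mul (by norm_num),
        Real.rpow_natCast, mul_left_comm, ← Real.rpow_add ht0]
      congr 2
      ring

theorem HasCompactSupport.postcompCLM {E : Type*} [NormedAddCommGroup E] [NormedSpace ℝ E]
    {f : 𝓢(E, F)} (hf : HasCompactSupport f) (L : F →L[ℝ] F') :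
    HasCompactSupport (f.postcompCLM L) :=
  hf.comp_left (g := L) (map_zero L)

theorem SchwartzMap.hasCompactSupport_sum {E ι : Type*} [NormedAddCommGroup E] [NormedSpace ℝ E]
    {S : Finset ι} {f : ι → 𝓢(E, F)} (hf : ∀ i ∈ S, HasCompactSupport (f i)) :
    HasCompactSupport (∑ i ∈ S, f i : 𝓢(E, F)) := by
  classical
  induction S using Finset.induction_on with
  | empty => exact HasCompactSupport.zero
  | insert a S ha ih =>
    rw [Finset.sum_insert ha]
    exact (hf a (S.mem_insert_self a)).add (ih fun i hi => hf i (Finset.mem_insert_of_mem hi))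

theorem SchwartzMap.iteratedLineDerivOp_sub {E : Type*} [NormedAddCommGroup E] [NormedSpace ℝ E]
    {m : ℕ} (v : Fin m → E) (f g : 𝓢(E, F)) : ∂^{v} (f - g) = ∂^{v} f - ∂^{v} g := by
  rw [sub_eq_add_neg, iteratedLineDerivOp_add, iteratedLineDerivOp_neg, ← sub_eq_add_neg]

variable [NormedAddCommGroup V] [InnerProductSpace ℝ V] [FiniteDimensional ℝ V]
  [NormedAddCommGroup W] [InnerProductSpace ℝ W] [FiniteDimensional ℝ W]

theorem iteratedLineDerivOp_cutScale_of_mem {n k : ℕ} (ζ : ContDiffBump (0 : Euc n))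
    (f : 𝓢(Euc n, F)) (v : Fin k → Euc n) (t : ℝ) {x : Euc n} (hx : x ∈ ball (0 : Euc n) ζ.rIn) :
    ∂^{v} (cutScale ζ f t) x = t ^ k • ∂^{v} f (t • x) := by
  rw [iteratedLineDerivOp_eq_iteratedFDeriv, iteratedLineDerivOp_eq_iteratedFDeriv]
  have h : (cutScale ζ f t : Euc n → F) =ᶠ[𝓝 x] fun y => f (t • y) := by
    filter_upwards [isOpen_ball.mem_nhds hx] with y hy
    rw [cutScale_apply, ζ.one_of_mem_closedBall (ball_subset_closedBall hy), one_smul]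
  rw [(h.iteratedFDeriv ℝ k).self_of_nhds,
    iteratedFDeriv_comp_const_smul _ (by exact_mod_cast f.smooth (k : ℕ∞))]
  rfl

set_option maxHeartbeats 1600000 in
/-- A sequence of compactly supported kernels: an approximate identity `θ N`, and
kernels `G N` solving the adjoint equation with right-hand side `θ (N + 1) - θ N`, up to
remainders `R N`, with geometrically decaying derivatives. -/
theorem exists_parametrix_sequence (n k : ℕ) (A : CoeffOp n k V W) (hell : IsElliptic n k A) :
    ∃ (ζ : ContDiffBump (0 : Euc n)) (ρ : 𝓢(Euc n, ℝ)), ∫ x, ρ x = 1 ∧ ∀ v : V,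
      ∃ (G : ℕ → 𝓢(Euc n, W)) (R : ℕ → 𝓢(Euc n, V)),
        (∀ N, HasCompactSupport (G N)) ∧ (∀ N, HasCompactSupport (R N)) ∧
        (∀ N, ∑ I : Fin k → Fin n, (∂^{fun i => stdVec n (I i)} (G N)).postcompCLM
          (LinearMap.adjoint (A I)).toContinuousLinearMap =
          (((2 : ℝ) ^ (N + 1)) ^ (n : ℝ) • cutScale ζ ρ (2 ^ (N + 1)) -
            ((2 : ℝ) ^ N) ^ (n : ℝ) • cutScale ζ ρ (2 ^ N)).postcompCLM
              ((ContinuousLinearMap.id ℝ ℝ).smulRight v) + R N) ∧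
        ∀ (m : ℕ) (α : Fin m → Fin n) (ε : ℝ), m + 1 ≤ k → 0 < ε → ε ≤ 1 → 0 < n - 1 + ε →
          DyadicDecay (2 ^ (-ε)) (n - 1 + ε) (ζ.rOut + 1)
            (fun N x => ∂^{fun i => stdVec n (α i)} (G N) x) ∧
          DyadicDecay (2 ^ (-ε)) (n - 1 + ε) (ζ.rOut + 1)
            (fun N x => ∂^{fun i => stdVec n (α i)} (R N) x) := by
  obtain ⟨ρ, hρ, hK⟩ := exists_dyadic_parametrix n k A hell
  let ζ : ContDiffBump (0 : Euc n) := ⟨1, 2, by norm_num, by norm_num⟩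
  refine ⟨ζ, ρ, hρ, fun v => ?_⟩
  obtain ⟨K, hK⟩ := hK v
  let θ : ℕ → 𝓢(Euc n, ℝ) := fun N => ((2 : ℝ) ^ N) ^ (n : ℝ) • cutScale ζ ρ (2 ^ N)
  let G : ℕ → 𝓢(Euc n, W) := fun N => ((2 : ℝ) ^ N) ^ ((n : ℝ) - k) • cutScale ζ K (2 ^ N)
  let L : (Fin k → Fin n) → W →L[ℝ] V := fun I => (LinearMap.adjoint (A I)).toContinuousLinearMap
  let D : ℕ → 𝓢(Euc n, V) := fun N =>
    ∑ I : Fin k → Fin n, (∂^{fun i => stdVec n (I i)} (G N)).postcompCLM (L I)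
  let Lv : ℝ →L[ℝ] V := (ContinuousLinearMap.id ℝ ℝ).smulRight v
  let R : ℕ → 𝓢(Euc n, V) := fun N => D N - (θ (N + 1) - θ N).postcompCLM Lv
  have hGc : ∀ N, HasCompactSupport (G N) := fun N =>
    (hasCompactSupport_cutScale ζ K (2 ^ N)).smul_left (f := fun _ => ((2 : ℝ) ^ N) ^ ((n : ℝ) - k))
  have hθc : ∀ N, HasCompactSupport (θ N) := fun N =>
    (hasCompactSupport_cutScale ζ ρ (2 ^ N)).smul_left (f := fun _ => ((2 : ℝ) ^ N) ^ (n : ℝ))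
  have hDc : ∀ N, HasCompactSupport (D N) := fun N => hasCompactSupport_sum fun I _ =>
    (SchwartzMap.hasCompactSupport_iteratedLineDerivOp _ (hGc N)).postcompCLM (L I)
  refine ⟨G, R, hGc, fun N => (hDc N).sub (((hθc _).sub (hθc _)).postcompCLM Lv), fun N => ?_, ?_⟩
  · simp only [R, D, L, Lv, θ]; abel
  intro m α ε hm hε hε1 hs
  have hq : (0 : ℝ) ≤ 2 ^ (-ε) := by positivity
  refine ⟨?_, ?_⟩
  · refine (dyadicDecay_cutScale ζ K α hs (n - k) 0).mono (by positivity) ?_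
    apply Real.rpow_le_rpow_of_exponent_le (by norm_num)
    have : (m : ℝ) + 1 ≤ k := by exact_mod_cast hm
    linarith
  -- away from the unit ball every term decays rapidly, and `R N` vanishes on the unit ball
  set r : ℝ := n + m + 1 with hr
  have hr0 : 0 < r := by positivity
  have hfar : DyadicDecay (2 ^ (-ε)) r (ζ.rOut + 1)
      (fun N x => ∂^{fun i => stdVec n (α i)} (R N) x) := by
    have hexp : ∀ a : ℝ, a ≤ -ε → (2 : ℝ) ^ a ≤ 2 ^ (-ε) := fun a ha =>
      Real.rpow_le_rpow_of_exponent_le (by norm_num) ha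
    have hθd : ∀ N₀, DyadicDecay (2 ^ (-ε)) r (ζ.rOut + 1)
        (fun N x => ∂^{fun i => stdVec n (α i)} (θ (N + N₀)) x) := fun N₀ =>
      (dyadicDecay_cutScale ζ ρ α hr0 n N₀).mono (by positivity) (hexp _ (by linarith))
    have hDd : ∀ I : Fin k → Fin n, DyadicDecay (2 ^ (-ε)) r (ζ.rOut + 1)
        (fun N x => L I (∂^{fun i => stdVec n (α i)} (∂^{fun i => stdVec n (I i)} (G N)) x)) := by
      intro I
      obtain ⟨γ, hγ⟩ := SchwartzMap.exists_iteratedLineDerivOp_comp_eq (F := W) (stdVec n) α I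
      simp only [hγ]
      refine ((dyadicDecay_cutScale ζ K γ hr0 (n - k) 0).mono (by positivity)
        (hexp _ ?_)).clm_comp (L I)
      push_cast
      linarith
    have := (DyadicDecay.sum hq Finset.univ fun I _ => hDd I).sub hq
      (((hθd 1).sub hq (hθd 0)).clm_comp Lv)
    convert this using 3 with N x
    simp only [R, D, iteratedLineDerivOp_sub, iteratedLineDerivOp_sum,
      iteratedLineDerivOp_postcompCLM, _root_.sub_apply, _root_.sum_apply, postcompCLM_apply,
      add_zero]
  obtain ⟨C, hC, h⟩ := hfar
  refine ⟨C, hC, fun N x => ?_⟩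
  by_cases hx : x ∈ ball (0 : Euc n) 1
  · have h0 : (R N : Euc n → V) =ᶠ[𝓝 x] 0 := by
      filter_upwards [isOpen_ball.mem_nhds hx] with y hy
      have ht : (0 : ℝ) < 2 ^ N := by positivity
      have hζ : ζ y = 1 := ζ.one_of_mem_closedBall (ball_subset_closedBall hy)
      simp only [R, D, G, θ, L, Lv, _root_.sub_apply, _root_.sum_apply, postcompCLM_apply,
        iteratedLineDerivOp_smul, _root_.smul_apply, LinearMap.coe_toContinuousLinearMap',
        iteratedLineDerivOp_cutScale_of_mem ζ K _ _ hy, cutScale_apply, hζ, map_smul,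
        ← Finset.smul_sum, hK, ContinuousLinearMap.smulRight_apply, ContinuousLinearMap.id_apply,
        smul_smul, Pi.zero_apply, ← sub_smul, smul_eq_mul, one_mul]
      rw [← Real.rpow_natCast (2 ^ N) k, ← mul_assoc, ← Real.rpow_add ht,
        sub_add_cancel, Real.rpow_natCast,
        Real.rpow_natCast, pow_succ (2 : ℝ) N, mul_pow, mul_comm _ (2 : ℝ)]
      convert zero_smul ℝ v
      ring
    beta_reduce
    rw [iteratedLineDerivOp_eq_iteratedFDeriv, (h0.iteratedFDeriv ℝ m).self_of_nhds]
    simp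
  · refine (h N x).trans ?_
    gcongr
    simp only [truncRiesz]
    apply Set.indicator_le_indicator
    have hx1 : 1 ≤ ‖x‖ₑ := by
      rw [← ofReal_norm, ENNReal.one_le_ofReal]
      simpa using hx
    exact ENNReal.rpow_le_rpow_of_exponent_le hx1 (by linarith)

end

section

variable {V W F : Type*} [NormedAddCommGroup F] [InnerProductSpace ℝ F]
  [NormedAddCommGroup V] [InnerProductSpace ℝ V] [FiniteDimensional ℝ V]
  [NormedAddCommGroup W] [InnerProductSpace ℝ W] [FiniteDimensional ℝ W]

theorem integrable_inner_comp_sub {n : ℕ} {μ : Measure (Euc n)} {f : Euc n → F}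
    (hf : LocallyIntegrable f μ) {g : Euc n → F} (hg : Continuous g) (hgc : HasCompactSupport g)
    (x : Euc n) : Integrable (fun y => ⟪f y, g (x - y)⟫) μ :=
  hgc.convolutionExists_right (innerSL ℝ : F →L[ℝ] F →L[ℝ] ℝ) hf hg x

theorem continuous_integral_inner_comp_sub {n : ℕ} {μ : Measure (Euc n)} {f : Euc n → F}
    (hf : LocallyIntegrable f μ) {g : Euc n → F} (hg : Continuous g)
    (hgc : HasCompactSupport g) : Continuous (fun x => ∫ y, ⟪f y, g (x - y)⟫ ∂μ) :=
  hgc.continuous_convolution_right (innerSL ℝ : F →L[ℝ] F →L[ℝ] ℝ) hf hg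

theorem iteratedFDeriv_comp_const_sub {E G : Type*} [NormedAddCommGroup E] [NormedSpace ℝ E]
    [NormedAddCommGroup G] [NormedSpace ℝ G] {f : E → G} {k : ℕ} (hf : ContDiff ℝ k f) (x y : E) :
    iteratedFDeriv ℝ k (fun z => f (x - z)) y = (-1 : ℝ) ^ k • iteratedFDeriv ℝ k f (x - y) := by
  have h := iteratedFDeriv_comp_const_smul (𝕜 := ℝ) (f := fun z => f (x + z)) (-1 : ℝ)
    (hf.comp (contDiff_const.add contDiff_id))
  simp only [neg_smul, one_smul, ← sub_eq_add_neg] at h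
  rw [h]
  beta_reduce
  rw [iteratedFDeriv_comp_add_left, ← sub_eq_add_neg]

/-- The equation `𝒜 u = f σ` tested with a reflected translate. -/
theorem HasDistribA.integral_comp_sub {n k : ℕ} {A : CoeffOp n k V W} {u : Euc n → V}
    {σ : Measure (Euc n)} {f : Euc n → W} (h : HasDistribA n k A u σ f)
    (hu : LocallyIntegrable u volume) {g : 𝓢(Euc n, W)} (hg : HasCompactSupport g) (x : Euc n) :
    ∫ y, ⟪u y, (∑ I : Fin k → Fin n, (∂^{fun i => stdVec n (I i)} g).postcompCLM
      (LinearMap.adjoint (A I)).toContinuousLinearMap : 𝓢(Euc n, V)) (x - y)⟫ =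
      ∫ y, ⟪f y, g (x - y)⟫ ∂σ := by
  have hφ : IsTestFun n (fun y => g (x - y)) :=
    ⟨(g.smooth ⊤).comp (contDiff_const.sub contDiff_id),
      hg.comp_homeomorph (Homeomorph.subLeft x)⟩
  rw [← h _ hφ, Finset.mul_sum]
  simp only [sum_apply, inner_sum]
  rw [integral_finsetSum]
  · refine Finset.sum_congr rfl fun I _ => ?_
    rw [← integral_const_mul]
    congr 1
    ext y
    simp only [dirDeriv, iteratedFDeriv_comp_const_sub (g.smooth (k : ℕ∞)), postcompCLM_apply,
      iteratedLineDerivOp_eq_iteratedFDeriv, LinearMap.coe_toContinuousLinearMap',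
      smul_apply, map_smul, inner_smul_right, ← mul_assoc, ← pow_add]
    rw [← two_mul, pow_mul]
    simp
  · intro I _
    exact integrable_inner_comp_sub hu (SchwartzMap.continuous _)
      ((SchwartzMap.hasCompactSupport_iteratedLineDerivOp _ hg).postcompCLM _) x

theorem isLocallyFiniteMeasure_withDensity_enorm {X : Type*} [TopologicalSpace X]
    [MeasurableSpace X] [OpensMeasurableSpace X] {G : Type*} [NormedAddCommGroup G]
    {μ : Measure X} {f : X → G}
    (hf : LocallyIntegrable f μ) : IsLocallyFiniteMeasure (μ.withDensity fun x => ‖f x‖ₑ) := by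
  refine ⟨fun x => ?_⟩
  obtain ⟨s, hs, hfs⟩ := hf x
  obtain ⟨t, hts, ht, hxt⟩ := mem_nhds_iff.mp hs
  refine ⟨t, ht.mem_nhds hxt, ?_⟩
  rw [withDensity_apply _ ht.measurableSet]
  exact (hfs.mono_set hts).2

theorem enorm_integral_inner_comp_sub_le {n : ℕ} {μ : Measure (Euc n)} [SFinite μ] {f : Euc n → F}
    (hf : LocallyIntegrable f μ) {g : Euc n → F} {c : ℝ≥0∞} {s R : ℝ}
    (hg : ∀ x, ‖g x‖ₑ ≤ c * truncRiesz n s R x) (hc : c ≠ ⊤) (x : Euc n) :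
    ‖∫ y, ⟪f y, g (x - y)⟫ ∂μ‖ₑ ≤ c * rieszPot n s R (μ.withDensity fun y => ‖f y‖ₑ) x := by
  have hm : Measurable fun y => truncRiesz n s R (x - y) :=
    (measurable_truncRiesz n s R).comp (measurable_const.sub measurable_id)
  rw [rieszPot, lintegral_withDensity_eq_lintegral_mul₀ hf.aestronglyMeasurable.enorm
    hm.aemeasurable, ← lintegral_const_mul' _ _ hc]
  refine (enorm_integral_le_lintegral_enorm _).trans (lintegral_mono fun y => ?_)
  have h1 : ‖⟪f y, g (x - y)⟫‖ₑ ≤ ‖f y‖ₑ * ‖g (x - y)‖ₑ := by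
    rw [← ofReal_norm, ← ofReal_norm, ← ofReal_norm, ← ENNReal.ofReal_mul (norm_nonneg _)]
    exact ENNReal.ofReal_le_ofReal (norm_inner_le_norm _ _)
  calc _ ≤ _ := h1
    _ ≤ ‖f y‖ₑ * (c * truncRiesz n s R (x - y)) := by gcongr; exact hg _
    _ = _ := by simp only [Pi.mul_apply]; ring

end

theorem lintegral_lt_top_of_lintegral_rpow_lt_top {n : ℕ} {p : ℝ} (hp : 1 ≤ p)
    {h : Euc n → ℝ≥0∞} {K : Set (Euc n)} (hK : IsCompact K)
    (hp' : ∫⁻ x in K, h x ^ p < ⊤) : ∫⁻ x in K, h x < ⊤ := by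
  have h1 : ∀ x, h x ≤ 1 + h x ^ p := by
    intro x
    rcases le_total (h x) 1 with hx | hx
    · exact hx.trans le_self_add
    · refine le_trans ?_ le_add_self
      simpa using ENNReal.rpow_le_rpow_of_exponent_le hx hp
  calc ∫⁻ x in K, h x ≤ ∫⁻ x in K, (1 + h x ^ p) := lintegral_mono h1
    _ = volume K + ∫⁻ x in K, h x ^ p := by
      rw [lintegral_add_left measurable_const, setLIntegral_one]
    _ < ⊤ := ENNReal.add_lt_top.mpr ⟨hK.measure_lt_top, hp'⟩

theorem ae_lt_top_of_forall_isCompact {n : ℕ} {h : Euc n → ℝ≥0∞} (hm : Measurable h)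
    (hK : ∀ K : Set (Euc n), IsCompact K → ∫⁻ x in K, h x < ⊤) : ∀ᵐ x, h x < ⊤ := by
  have h1 : ∀ N : ℕ, ∀ᵐ x, x ∈ closedBall (0 : Euc n) N → h x < ⊤ := fun N =>
    (ae_restrict_iff' measurableSet_closedBall).mp
      (ae_lt_top hm (hK _ (isCompact_closedBall 0 N)).ne)
  filter_upwards [ae_all_iff.mpr h1] with x hx
  obtain ⟨N, hN⟩ := exists_nat_ge ‖x‖
  exact hx N (by simpa using hN)

/-- A sequence of continuous functions whose increments decay geometrically relative to a locally
`p`-integrable function converges, in the sense of distributions, to an `L^p_loc` function. -/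
theorem exists_locLp_tendsto_integral_mul {n : ℕ} {p : ℝ} (hp : 1 ≤ p) {h : Euc n → ℝ≥0∞}
    (hm : Measurable h) (hh : ∀ K : Set (Euc n), IsCompact K → ∫⁻ x in K, h x ^ p < ⊤)
    {P : ℕ → Euc n → ℝ} (hP : ∀ N, Continuous (P N)) {C q : ℝ} (hC : 0 ≤ C) (hq : 0 ≤ q)
    (hq1 : q < 1) (hPh : ∀ N x, ‖P (N + 1) x - P N x‖ₑ ≤ ENNReal.ofReal (C * q ^ N) * h x) :
    ∃ w : Euc n → ℝ, LocallyIntegrable w volume ∧ LocLp n p w ∧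
      ∀ φ : Euc n → ℝ, Continuous φ → HasCompactSupport φ →
        Tendsto (fun N => ∫ x, φ x * P N x) atTop (𝓝 (∫ x, φ x * w x)) := by
  set H : Euc n → ℝ≥0∞ := fun x => ‖P 0 x‖ₑ + ENNReal.ofReal (C / (1 - q)) * h x with hH
  have hHm : Measurable H := (hP 0).measurable.enorm.add (hm.const_mul _)
  have hHp : ∀ K : Set (Euc n), IsCompact K → ∫⁻ x in K, H x ^ p < ⊤ := by
    intro K hK
    obtain ⟨M, hM⟩ := hK.exists_bound_of_continuousOn (hP 0).continuousOn
    have h1 : ∀ x ∈ K, H x ^ p ≤ 2 ^ (p - 1) * (ENNReal.ofReal M ^ p +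
        ENNReal.ofReal (C / (1 - q)) ^ p * h x ^ p) := by
      intro x hx
      refine (ENNReal.rpow_add_le_mul_rpow_add_rpow _ _ hp).trans ?_
      rw [ENNReal.mul_rpow_of_nonneg _ _ (by linarith)]
      gcongr
      rw [← ofReal_norm]
      exact ENNReal.ofReal_le_ofReal (hM x hx)
    refine (setLIntegral_mono' hK.measurableSet h1).trans_lt ?_
    rw [lintegral_const_mul' _ _ (by finiteness), lintegral_add_left measurable_const,
      lintegral_const_mul' _ _ (by finiteness), setLIntegral_const]
    have := hK.measure_lt_top (μ := (volume : Measure (Euc n)))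
    have := hh K hK
    finiteness
  have hH1 : ∀ K : Set (Euc n), IsCompact K → ∫⁻ x in K, H x < ⊤ := fun K hK =>
    lintegral_lt_top_of_lintegral_rpow_lt_top hp hK (hHp K hK)
  have hHfin := ae_lt_top_of_forall_isCompact hHm hH1
  have hhfin := ae_lt_top_of_forall_isCompact hm fun K hK =>
    lintegral_lt_top_of_lintegral_rpow_lt_top hp hK (hh K hK)
  have hHint : LocallyIntegrable (fun x => (H x).toReal) volume := by
    rw [locallyIntegrable_iff]
    intro K hK
    exact integrable_toReal_of_lintegral_ne_top hHm.aemeasurable (hH1 K hK).ne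
  have hbound : ∀ N x, ‖P N x‖ₑ ≤ H x := by
    intro N x
    have h1 : ∀ N, ‖P N x‖ₑ ≤
        ‖P 0 x‖ₑ + ENNReal.ofReal (∑ j ∈ Finset.range N, C * q ^ j) * h x := by
      intro N
      induction N with
      | zero => simp
      | succ N ih =>
        rw [Finset.sum_range_succ, ENNReal.ofReal_add
          (Finset.sum_nonneg fun j _ => by positivity) (by positivity), add_mul, ← add_assoc]
        calc ‖P (N + 1) x‖ₑ = ‖P N x + (P (N + 1) x - P N x)‖ₑ := by rw [add_sub_cancel]
          _ ≤ _ := enorm_add_le _ _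
          _ ≤ _ := add_le_add ih (hPh N x)
    refine (h1 N).trans ?_
    simp only [hH]
    gcongr
    rw [← Finset.mul_sum, div_eq_mul_inv]
    gcongr
    rw [← tsum_geometric_of_lt_one hq hq1]
    exact (summable_geometric_of_lt_one hq hq1).sum_le_tsum _ (fun _ _ => by positivity)
  have hlim : ∀ᵐ x, ∃ l, Tendsto (fun N => P N x) atTop (𝓝 l) := by
    filter_upwards [hhfin] with x hx
    refine cauchySeq_tendsto_of_complete
      (cauchySeq_of_le_geometric q (C * (h x).toReal) hq1 fun N => ?_)
    rw [dist_comm, dist_eq_norm, ← toReal_enorm]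
    refine (ENNReal.toReal_mono (by finiteness) (hPh N x)).trans (le_of_eq ?_)
    rw [ENNReal.toReal_mul, ENNReal.toReal_ofReal (by positivity)]
    ring
  let w : Euc n → ℝ := fun x => limUnder atTop fun N => P N x
  have hw : ∀ᵐ x, Tendsto (fun N => P N x) atTop (𝓝 (w x)) := by
    filter_upwards [hlim] with x hx using tendsto_nhds_limUnder hx
  have hwm : AEStronglyMeasurable w volume :=
    aestronglyMeasurable_of_tendsto_ae atTop (fun N => (hP N).aestronglyMeasurable) hw
  have hwH : ∀ᵐ x, ‖w x‖ₑ ≤ H x := by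
    filter_upwards [hw] with x hx
    exact le_of_tendsto hx.enorm (Eventually.of_forall fun N => hbound N x)
  refine ⟨w, ?_, fun K hK => ?_, fun φ hφ hφc => ?_⟩
  · rw [locallyIntegrable_iff]
    intro K hK
    exact ⟨hwm.restrict, (lintegral_mono_ae (ae_restrict_of_ae hwH)).trans_lt (hH1 K hK)⟩
  · refine (lintegral_mono_ae ?_).trans_lt (hHp K hK)
    filter_upwards [ae_restrict_of_ae hwH] with x hx
    exact ENNReal.rpow_le_rpow hx (by linarith)
  · refine tendsto_integral_of_dominated_convergence (fun x => ‖φ x‖ * (H x).toReal)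
      (fun N => (hφ.mul (hP N)).aestronglyMeasurable) ?_ (fun N => ?_) ?_
    · simpa only [smul_eq_mul] using
        hHint.integrable_smul_left_of_hasCompactSupport hφ.norm hφc.norm
    · filter_upwards [hHfin] with x hx
      rw [norm_mul, ← toReal_enorm (P N x)]
      gcongr
      · exact hx.ne
      · exact hbound N x
    · filter_upwards [hw] with x hx using hx.const_mul _

theorem integral_mul_integral_mul_comp_sub {n : ℕ} {φ U g : Euc n → ℝ} (hφ : Continuous φ)
    (hφc : HasCompactSupport φ) (hU : LocallyIntegrable U volume) (hg : Continuous g)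
    (hgc : HasCompactSupport g) :
    ∫ x, φ x * ∫ y, U y * g (x - y) = ∫ y, U y * ∫ x, φ x * g (x - y) := by
  obtain ⟨r, hr⟩ := hφc.isCompact.isBounded.subset_closedBall 0
  obtain ⟨R, hR⟩ := hgc.isCompact.isBounded.subset_closedBall 0
  obtain ⟨M, hM⟩ := hg.bounded_above_of_compact_support hgc
  have hint : Integrable (Function.uncurry fun x y => φ x * (U y * g (x - y)))
      (volume.prod volume) := by
    have h1 : Integrable ((closedBall (0 : Euc n) (r + R)).indicator U) volume :=
      (hU.integrableOn_isCompact (isCompact_closedBall _ _)).integrable_indicator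
        measurableSet_closedBall
    have h2 := ((hφ.integrable_of_hasCompactSupport (μ := volume) hφc).mul_prod h1).mul_bdd (c := M)
      (g := fun z : Euc n × Euc n => g (z.1 - z.2))
      (hg.comp (continuous_fst.sub continuous_snd)).aestronglyMeasurable
      (Eventually.of_forall fun z => hM _)
    refine h2.congr (Eventually.of_forall fun z => ?_)
    obtain ⟨x, y⟩ := z
    simp only [Function.uncurry]
    by_cases hy : y ∈ closedBall (0 : Euc n) (r + R)
    · rw [Set.indicator_of_mem hy, mul_assoc]
    · have h0 : φ x * g (x - y) = 0 := by
        by_contra h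
        have hx := hr (subset_tsupport _ (left_ne_zero_of_mul h))
        have hxy := hR (subset_tsupport _ (right_ne_zero_of_mul h))
        apply hy
        simp only [mem_closedBall, dist_zero_right] at hx hxy ⊢
        have := norm_sub_norm_le y x
        rw [norm_sub_rev] at this
        linarith
      rw [Set.indicator_of_notMem hy]
      linear_combination -U y * h0
  simp_rw [← integral_const_mul]
  rw [integral_integral_swap hint]
  simp_rw [mul_left_comm]

theorem integral_mul_iteratedLineDerivOp_comp_sub {n m : ℕ} (v : Fin m → Euc n)
    (φ g : 𝓢(Euc n, ℝ)) (y : Euc n) :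
    ∫ x, φ x * ∂^{v} g (x - y) = (-1) ^ m * ∫ x, ∂^{v} φ x * g (x - y) := by
  have h := SchwartzMap.integral_mul_iteratedLineDerivOp volume v φ (g.compSubConstCLM ℝ y)
  simp only [compSubConstCLM_apply] at h
  rw [← h]
  congr 1
  ext x
  rw [iteratedLineDerivOp_eq_iteratedFDeriv, iteratedLineDerivOp_eq_iteratedFDeriv]
  have : (g.compSubConstCLM ℝ y : Euc n → ℝ) = fun x => g (x - y) := by
    ext x; simp
  rw [this, iteratedFDeriv_comp_sub]

theorem integral_mul_cutScale_comp_sub {n : ℕ} (ζ : ContDiffBump (0 : Euc n)) (ρ : 𝓢(Euc n, ℝ))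
    (ψ : Euc n → ℝ) {t : ℝ} (ht : 0 < t) (y : Euc n) :
    ∫ x, ψ x * (t ^ (n : ℝ) • cutScale ζ ρ t) (x - y) =
      ∫ z, ψ (t⁻¹ • z + y) * ζ (t⁻¹ • z) * ρ z := by
  have h1 := integral_add_right_eq_self (μ := volume)
    (fun x => ψ x * (t ^ (n : ℝ) • cutScale ζ ρ t) (x - y)) y
  have h2 := Measure.integral_comp_smul (volume : Measure (Euc n))
    (fun z => ψ (t⁻¹ • z + y) * ζ (t⁻¹ • z) * ρ z) t
  rw [← h1]
  simp only [finrank_euclideanSpace, Fintype.card_fin, smul_smul, inv_mul_cancel₀ ht.ne',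
    one_smul, abs_of_pos (inv_pos.mpr (pow_pos ht n)), smul_eq_mul] at h2
  rw [eq_inv_mul_iff_mul_eq₀ (pow_pos ht n).ne', ← integral_const_mul] at h2
  rw [← h2]
  congr 1
  ext z
  simp only [add_sub_cancel_right, smul_apply, cutScale_apply, smul_eq_mul, Real.rpow_natCast]
  ring

theorem tendsto_integral_mul_approxIdentity {n : ℕ} (ζ : ContDiffBump (0 : Euc n))
    (ρ : 𝓢(Euc n, ℝ)) (hρ : ∫ x, ρ x = 1) {U ψ : Euc n → ℝ} (hU : LocallyIntegrable U volume)
    (hψ : Continuous ψ) (hψc : HasCompactSupport ψ) :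
    Tendsto (fun N : ℕ => ∫ y, U y * ∫ x, ψ x *
      (((2 : ℝ) ^ N) ^ (n : ℝ) • cutScale ζ ρ (2 ^ N)) (x - y)) atTop (𝓝 (∫ y, U y * ψ y)) := by
  obtain ⟨M, hM⟩ := hψ.bounded_above_of_compact_support hψc
  have hM0 : 0 ≤ M := (norm_nonneg _).trans (hM 0)
  obtain ⟨r, hr⟩ := hψc.isCompact.isBounded.subset_closedBall 0
  have hρi : Integrable (fun z => ‖ρ z‖) volume := (ρ.integrable).norm
  have ht : ∀ N : ℕ, (0 : ℝ) < 2 ^ N := fun N => by positivity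
  have hζ1 : ∀ z, ‖ζ z‖ ≤ 1 := fun z => by
    rw [Real.norm_of_nonneg ζ.nonneg]; exact ζ.le_one
  have hb : ∀ (N : ℕ) y z,
      ‖ψ (((2 : ℝ) ^ N)⁻¹ • z + y) * ζ (((2 : ℝ) ^ N)⁻¹ • z) * ρ z‖ ≤ M * ‖ρ z‖ := by
    intro N y z
    rw [norm_mul, norm_mul]
    gcongr
    calc _ ≤ M * 1 := mul_le_mul (hM _) (hζ1 _) (norm_nonneg _) hM0
      _ = M := mul_one M
  simp_rw [integral_mul_cutScale_comp_sub ζ ρ ψ (ht _)]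
  set B : Set (Euc n) := closedBall 0 (r + ζ.rOut)
  have hcont : ∀ N : ℕ, Continuous (fun y =>
      ∫ z, ψ (((2 : ℝ) ^ N)⁻¹ • z + y) * ζ (((2 : ℝ) ^ N)⁻¹ • z) * ρ z) := by
    intro N
    refine continuous_of_dominated (fun y => ?_) (fun y => Eventually.of_forall (hb N y))
      (hρi.const_mul M) (Eventually.of_forall fun z => ?_)
    · have := ζ.continuous
      have := ρ.continuous
      exact Continuous.aestronglyMeasurable (by fun_prop)
    · fun_prop
  have hUB : Integrable (B.indicator fun y => ‖U y‖ * (M * ∫ z, ‖ρ z‖)) volume :=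
    (integrable_indicator_iff measurableSet_closedBall).mpr
      ((hU.integrableOn_isCompact (isCompact_closedBall _ _)).norm.mul_const _)
  refine tendsto_integral_of_dominated_convergence _
    (fun N => hU.aestronglyMeasurable.mul (hcont N).aestronglyMeasurable) hUB
    (fun N => Eventually.of_forall fun y => ?_) (Eventually.of_forall fun y => ?_)
  · by_cases hy : y ∈ B
    · rw [Set.indicator_of_mem hy, norm_mul]
      gcongr
      rw [← integral_const_mul]
      exact norm_integral_le_of_norm_le (hρi.const_mul M) (Eventually.of_forall (hb N y))
    · rw [Set.indicator_of_notMem hy]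
      have h0 : ∀ z, ψ (((2 : ℝ) ^ N)⁻¹ • z + y) * ζ (((2 : ℝ) ^ N)⁻¹ • z) * ρ z = 0 := by
        intro z
        by_contra h
        have h1 := hr (subset_tsupport _ (left_ne_zero_of_mul (left_ne_zero_of_mul h)))
        have h2 : ((2 : ℝ) ^ N)⁻¹ • z ∈ Function.support ζ :=
          right_ne_zero_of_mul (left_ne_zero_of_mul h)
        rw [ζ.support_eq] at h2
        apply hy
        simp only [B, mem_closedBall, mem_ball, dist_zero_right] at h1 h2 ⊢
        have := norm_sub_le_norm_add y (((2 : ℝ) ^ N)⁻¹ • z)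
        rw [add_comm] at this
        linarith
      simp [h0]
  · refine Tendsto.const_mul _ ?_
    have hlim : ∫ z, ψ y * ρ z = ψ y := by rw [integral_const_mul, hρ, mul_one]
    rw [← hlim]
    refine tendsto_integral_of_dominated_convergence _ (fun N => ?_) (hρi.const_mul M)
      (fun N => Eventually.of_forall (hb N y)) (Eventually.of_forall fun z => ?_)
    · have := ζ.continuous
      have := ρ.continuous
      exact Continuous.aestronglyMeasurable (by fun_prop)
    · have hz : Tendsto (fun N : ℕ => ((2 : ℝ) ^ N)⁻¹ • z) atTop (𝓝 0) := by
        have : Tendsto (fun N : ℕ => ((2 : ℝ) ^ N)⁻¹) atTop (𝓝 0) :=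
          tendsto_inv_atTop_zero.comp (tendsto_pow_atTop_atTop_of_one_lt (by norm_num))
        simpa using this.smul_const z
      have h1 : Tendsto (fun N : ℕ => ψ (((2 : ℝ) ^ N)⁻¹ • z + y)) atTop (𝓝 (ψ y)) := by
        have := (hψ.tendsto (0 + y)).comp (hz.add_const y)
        rwa [zero_add] at this
      have h2 : Tendsto (fun N : ℕ => ζ (((2 : ℝ) ^ N)⁻¹ • z)) atTop (𝓝 1) := by
        have := (ζ.continuous.tendsto 0).comp hz
        rwa [ζ.one_of_mem_closedBall (mem_closedBall_self ζ.rIn_pos.le)] at this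
      simpa using (h1.mul h2).mul_const (ρ z)

section

variable {V W : Type*}
  [NormedAddCommGroup V] [InnerProductSpace ℝ V] [FiniteDimensional ℝ V]
  [NormedAddCommGroup W] [InnerProductSpace ℝ W] [FiniteDimensional ℝ W]

theorem MemBVAloc.exists_locLp_weakDeriv_inner {n k : ℕ} (hn : 1 ≤ n) {A : CoeffOp n k V W}
    (hell : IsElliptic n k A) {u : Euc n → V} (hu : MemBVAloc n k A u) {p : ℝ} (hp1 : 1 ≤ p)
    (hp2 : p * ((n : ℝ) - 1) < n) {m : ℕ} (hm : m + 1 ≤ k) (α : Fin m → Fin n) (v : V) :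
    ∃ w : Euc n → ℝ, LocallyIntegrable w volume ∧ LocLp n p w ∧
      ∀ φ : Euc n → ℝ, IsTestFun n φ →
        ∫ x, dirDeriv n m α φ x * ⟪v, u x⟫ = (-1 : ℝ) ^ m * ∫ x, φ x * w x := by
  obtain ⟨hul, σ, f, hσ, hf, -, hA⟩ := hu
  obtain ⟨ζ, ρ, hρ, hpar⟩ := exists_parametrix_sequence n k A hell
  obtain ⟨G, R, hG, hR, hGR, hdecay⟩ := hpar v
  obtain ⟨ε, hε, hε1, hs, hps⟩ : ∃ ε : ℝ, 0 < ε ∧ ε ≤ 1 ∧ 0 < n - 1 + ε ∧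
      p * (n - 1 + ε) < n := by
    have hn' : (1 : ℝ) ≤ n := by exact_mod_cast hn
    have hpos : 0 < (n - p * ((n : ℝ) - 1)) / (2 * p) := div_pos (by linarith) (by linarith)
    have hε : 0 < min 1 ((n - p * ((n : ℝ) - 1)) / (2 * p)) := lt_min one_pos hpos
    refine ⟨_, hε, min_le_left _ _, by linarith, ?_⟩
    calc p * (n - 1 + min 1 ((n - p * ((n : ℝ) - 1)) / (2 * p)))
        ≤ p * (n - 1 + (n - p * ((n : ℝ) - 1)) / (2 * p)) := by
          gcongr
          exact min_le_right _ _
      _ = p * (n - 1) + (n - p * (n - 1)) / 2 := by field_simp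
      _ < n := by linarith
  obtain ⟨⟨C₁, hC₁, hGd⟩, ⟨C₂, hC₂, hRd⟩⟩ := hdecay m α ε hm hε hε1 hs
  set q : ℝ := 2 ^ (-ε) with hq
  have hq0 : 0 ≤ q := by positivity
  have hq1 : q < 1 := Real.rpow_lt_one_of_one_lt_of_neg (by norm_num) (by linarith)
  have := isLocallyFiniteMeasure_withDensity_enorm hf
  have := isLocallyFiniteMeasure_withDensity_enorm hul
  set μ₁ : Measure (Euc n) := σ.withDensity fun y => ‖f y‖ₑ
  set μ₂ : Measure (Euc n) := volume.withDensity fun y => ‖u y‖ₑ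
  have hloc : IsLocallyFiniteMeasure (μ₁ + μ₂) := ⟨fun x =>
    let ⟨s, hs, hs'⟩ := μ₁.finiteAt_nhds x
    let ⟨t, ht, ht'⟩ := μ₂.finiteAt_nhds x
    ⟨s ∩ t, inter_mem hs ht, ENNReal.add_lt_top.mpr
      ⟨(measure_mono Set.inter_subset_left).trans_lt hs',
        (measure_mono Set.inter_subset_right).trans_lt ht'⟩⟩⟩
  let θ : ℕ → 𝓢(Euc n, ℝ) := fun N => ((2 : ℝ) ^ N) ^ (n : ℝ) • cutScale ζ ρ (2 ^ N)
  let e : Fin m → Euc n := fun i => stdVec n (α i)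
  have hθc : ∀ N, HasCompactSupport (∂^{e} (θ N) : 𝓢(Euc n, ℝ)) := fun N =>
    SchwartzMap.hasCompactSupport_iteratedLineDerivOp _
      ((hasCompactSupport_cutScale ζ ρ (2 ^ N)).smul_left
        (f := fun _ => ((2 : ℝ) ^ N) ^ (n : ℝ)))
  have hU : LocallyIntegrable (fun y => ⟪v, u y⟫) volume := by
    rw [locallyIntegrable_iff]
    intro K hK
    exact (hul.integrableOn_isCompact hK).const_inner v
  let P : ℕ → Euc n → ℝ := fun N x => ∫ y, ⟪v, u y⟫ * ∂^{e} (θ N) (x - y)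
  have hPc : ∀ N, Continuous (P N) := by
    intro N
    have := continuous_integral_inner_comp_sub hU (SchwartzMap.continuous (∂^{e} (θ N))) (hθc N)
    simpa only [P, real_inner_eq_re_inner, RCLike.inner_apply, conj_trivial, mul_comm,
      RCLike.re_to_real] using this
  have hinc : ∀ N x, P (N + 1) x - P N x =
      ∫ y, ⟪f y, ∂^{e} (G N) (x - y)⟫ ∂σ - ∫ y, ⟪u y, ∂^{e} (R N) (x - y)⟫ := by
    intro N x
    have hD : (∑ I : Fin k → Fin n, (∂^{fun i => stdVec n (I i)} (∂^{e} (G N))).postcompCLM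
        (LinearMap.adjoint (A I)).toContinuousLinearMap : 𝓢(Euc n, V)) =
        (∂^{e} (θ (N + 1)) - ∂^{e} (θ N)).postcompCLM
          ((ContinuousLinearMap.id ℝ ℝ).smulRight v) + ∂^{e} (R N) := by
      rw [← SchwartzMap.iteratedLineDerivOp_sub, ← SchwartzMap.iteratedLineDerivOp_postcompCLM,
        ← iteratedLineDerivOp_add, ← hGR N, iteratedLineDerivOp_sum]
      refine Finset.sum_congr rfl fun I _ => ?_
      rw [SchwartzMap.iteratedLineDerivOp_comm, SchwartzMap.iteratedLineDerivOp_postcompCLM]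
    have hpt : ∀ y, ⟪u y, (∑ I : Fin k → Fin n, (∂^{fun i => stdVec n (I i)}
          (∂^{e} (G N))).postcompCLM
          (LinearMap.adjoint (A I)).toContinuousLinearMap : 𝓢(Euc n, V)) (x - y)⟫ =
        ⟪v, u y⟫ * ∂^{e} (θ (N + 1)) (x - y) - ⟪v, u y⟫ * ∂^{e} (θ N) (x - y) +
          ⟪u y, ∂^{e} (R N) (x - y)⟫ := by
      intro y
      rw [hD, add_apply, inner_add_right, postcompCLM_apply, sub_apply]
      simp only [ContinuousLinearMap.smulRight_apply, ContinuousLinearMap.id_apply,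
        inner_smul_right, real_inner_comm]
      ring
    have hPi : ∀ N, Integrable (fun y => ⟪v, u y⟫ * ∂^{e} (θ N) (x - y)) volume := by
      intro N
      have := integrable_inner_comp_sub hU (SchwartzMap.continuous (∂^{e} (θ N))) (hθc N) x
      simpa only [real_inner_eq_re_inner, RCLike.inner_apply, conj_trivial, mul_comm,
        RCLike.re_to_real] using this
    have hRi := integrable_inner_comp_sub hul (SchwartzMap.continuous (∂^{e} (R N)))
      (SchwartzMap.hasCompactSupport_iteratedLineDerivOp e (hR N)) x
    rw [← hA.integral_comp_sub hul
      (SchwartzMap.hasCompactSupport_iteratedLineDerivOp e (hG N)) x]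
    have hPi' : Integrable (fun y => ⟪v, u y⟫ * ∂^{e} (θ (N + 1)) (x - y) -
        ⟪v, u y⟫ * ∂^{e} (θ N) (x - y)) volume := (hPi _).sub (hPi _)
    rw [integral_congr_ae (.of_forall hpt), integral_add hPi' hRi,
      integral_sub (hPi _) (hPi _), add_sub_cancel_right]
  have hPd : ∀ N x, ‖P (N + 1) x - P N x‖ₑ ≤ ENNReal.ofReal ((C₁ + C₂) * q ^ N) *
      rieszPot n (n - 1 + ε) (ζ.rOut + 1) (μ₁ + μ₂) x := by
    intro N x
    rw [hinc]
    refine enorm_sub_le.trans ?_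
    have h1 := enorm_integral_inner_comp_sub_le hf (hGd N) ENNReal.ofReal_ne_top x
    have h2 := enorm_integral_inner_comp_sub_le hul (hRd N) ENNReal.ofReal_ne_top x
    refine (add_le_add h1 h2).trans ?_
    have h3 : rieszPot n (n - 1 + ε) (ζ.rOut + 1) (μ₁ + μ₂) x =
        rieszPot n (n - 1 + ε) (ζ.rOut + 1) μ₁ x + rieszPot n (n - 1 + ε) (ζ.rOut + 1) μ₂ x :=
      lintegral_add_measure _ _ _
    rw [h3, mul_add]
    gcongr <;> linarith
  obtain ⟨w, hwl, hwp, hw⟩ := exists_locLp_tendsto_integral_mul hp1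
    (measurable_rieszPot n (n - 1 + ε) (ζ.rOut + 1) (μ₁ + μ₂))
    (fun K hK => lintegral_rieszPot_rpow_lt_top hn hp1 hps _ hK) hPc (add_nonneg hC₁ hC₂)
    hq0 hq1 hPd
  refine ⟨w, hwl, hwp, fun φ hφ => ?_⟩
  let Φ : 𝓢(Euc n, ℝ) := hφ.2.toSchwartzMap hφ.1
  have hΦ : (Φ : Euc n → ℝ) = φ := rfl
  have h1 := hw φ hφ.1.continuous hφ.2
  have h2 := (tendsto_integral_mul_approxIdentity ζ ρ hρ hU (∂^{e} Φ).continuous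
    (SchwartzMap.hasCompactSupport_iteratedLineDerivOp e (f := Φ) hφ.2)).const_mul ((-1 : ℝ) ^ m)
  have h3 : ∀ N, ∫ x, φ x * P N x = (-1 : ℝ) ^ m * ∫ y, ⟪v, u y⟫ * ∫ x, ∂^{e} Φ x *
      (((2 : ℝ) ^ N) ^ (n : ℝ) • cutScale ζ ρ (2 ^ N)) (x - y) := by
    intro N
    rw [integral_mul_integral_mul_comp_sub hφ.1.continuous hφ.2 hU
      (SchwartzMap.continuous (∂^{e} (θ N))) (hθc N), ← integral_const_mul]
    congr 1
    ext y
    rw [← hΦ, integral_mul_iteratedLineDerivOp_comp_sub e Φ (θ N) y]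
    ring
  simp only [h3] at h1
  rw [tendsto_nhds_unique h1 h2, ← hΦ, dirDeriv_schwartz, ← mul_assoc, ← mul_pow]
  simp [mul_comm, e]

theorem LocLp.sum_smul {E : Type*} [NormedAddCommGroup E] [NormedSpace ℝ E] {n : ℕ} {p : ℝ}
    (hp : 1 ≤ p) {ι : Type*} (S : Finset ι) {w : ι → Euc n → ℝ}
    (hwm : ∀ c ∈ S, LocallyIntegrable (w c) volume)
    (hw : ∀ c ∈ S, LocLp n p (w c)) (e : ι → E) (he : ∀ c, ‖e c‖ = 1) :
    LocLp n p (fun x => ∑ c ∈ S, w c x • e c) := by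
  intro K hK
  have h1 : ∀ x, (‖∑ c ∈ S, w c x • e c‖₊ : ℝ≥0∞) ^ p ≤
      (S.card : ℝ≥0∞) ^ (p - 1) * ∑ c ∈ S, (‖w c x‖₊ : ℝ≥0∞) ^ p := by
    intro x
    refine le_trans (ENNReal.rpow_le_rpow ?_ (by linarith))
      (ENNReal.rpow_sum_le_const_mul_sum_rpow S _ hp)
    refine (enorm_sum_le S fun c => w c x • e c).trans
      (le_of_eq (Finset.sum_congr rfl fun c _ => ?_))
    rw [enorm_smul, ← ofReal_norm (e c), he, ENNReal.ofReal_one, mul_one]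
    rfl
  refine (lintegral_mono h1).trans_lt ?_
  rw [lintegral_const_mul' _ _ (by finiteness), lintegral_finsetSum']
  · refine ENNReal.mul_lt_top (by finiteness) (ENNReal.sum_lt_top.mpr fun c hc => hw c hc K hK)
  · intro c hc
    exact ((hwm c hc).aestronglyMeasurable.restrict.enorm).pow_const p

end

/-- Lemma 2.2: if `𝒜` is elliptic and `u ∈ L¹_loc` has `𝒜 u` a Radon
measure, then `u ∈ W^{k-1,p}_loc` for every `1 ≤ p < n/(n-1)` (with `n/(n-1) = ∞` if `n = 1`,
encoded as `p (n-1) < n`): all weak derivatives of order `m ≤ k-1` exist and lie in `L^p_loc`. -/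
theorem statement9 (n k : ℕ) (hn : 1 ≤ n) (hk : 1 ≤ k) {V W : Type*}
    [NormedAddCommGroup V] [InnerProductSpace ℝ V] [FiniteDimensional ℝ V]
    [NormedAddCommGroup W] [InnerProductSpace ℝ W] [FiniteDimensional ℝ W]
    (A : CoeffOp n k V W) (hA : IsSymmetricOp n k A) (hell : IsElliptic n k A)
    (u : Euc n → V) (hu : MemBVAloc n k A u)
    (p : ℝ) (hp1 : 1 ≤ p) (hp2 : p * ((n : ℝ) - 1) < n) :
    ∀ m : ℕ, m ≤ k - 1 →
      ∃ v : (Fin m → Fin n) → Euc n → V, IsWeakDerivFamily n m u v ∧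
        ∀ I, LocLp n p (v I) := by
  intro m hm
  let b := stdOrthonormalBasis ℝ V
  choose w hwl hwp hw using fun (I : Fin m → Fin n) c =>
    hu.exists_locLp_weakDeriv_inner hn hell hp1 hp2 (by omega : m + 1 ≤ k) I (b c)
  have hvl : ∀ I, LocallyIntegrable (fun x => ∑ c, w I c x • b c) volume := by
    intro I
    rw [locallyIntegrable_iff]
    intro K hK
    exact integrable_finsetSum _ fun c _ =>
      ((hwl I c).integrableOn_isCompact hK).smul_const (b c)
  refine ⟨fun I x => ∑ c, w I c x • b c, ⟨hvl, fun I φ hφ => ?_⟩, fun I =>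
    .sum_smul hp1 _ (fun c _ => hwl I c) (fun c _ => hwp I c) b fun c => b.norm_eq_one c⟩
  let Φ : 𝓢(Euc n, ℝ) := hφ.2.toSchwartzMap hφ.1
  have hΦ : (Φ : Euc n → ℝ) = φ := rfl
  have hint1 : Integrable (fun x => dirDeriv n m I φ x • u x) volume := by
    rw [← hΦ, dirDeriv_schwartz]
    exact hu.1.integrable_smul_left_of_hasCompactSupport (SchwartzMap.continuous _)
      (SchwartzMap.hasCompactSupport_iteratedLineDerivOp _ (f := Φ) hφ.2)
  have hint2 := (hvl I).integrable_smul_left_of_hasCompactSupport hφ.1.continuous hφ.2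
  refine b.repr.injective (PiLp.ext fun c => ?_)
  rw [b.repr_apply_apply, b.repr_apply_apply, ← integral_inner hint1,
    inner_smul_right, ← integral_inner hint2]
  simp only [inner_smul_right, inner_sum, b.inner_eq_ite, mul_ite, mul_one, mul_zero,
    Finset.sum_ite_eq, Finset.mem_univ, if_true]
  exact hw I c φ hφ
end

section
/- Let 1 ≤ p < n, let u ∈ W^{k−1,p}_loc(ℝ^n, V), and let x ∈ ℝ^n be such that D^{k−1}u ∈ t^{1,p}(x). Then D^{k−j}u ∈ t^{j,p}(x) for every j = 1, …, k. -/
open MeasureTheory Metric Filter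
open scoped ENNReal RealInnerProductSpace Topology

section Polynomials

variable {n : ℕ}

lemma IsPolyDeg.iteratedFDeriv_eq_zero {F : Type*} [NormedAddCommGroup F] [NormedSpace ℝ F]
    {j : ℕ} {P : Euc n → F} (hP : IsPolyDeg n j P) {m : ℕ} (hm : j < m) (x : Euc n) :
    iteratedFDeriv ℝ m P x = 0 := by
  have key : ∀ i : ℕ, iteratedFDeriv ℝ (j + 1 + i) P = 0 := by
    intro i
    induction i with
    | zero => exact funext hP.2
    | succ i ih =>
      ext y v
      refine (iteratedFDeriv_succ_apply_left (n := j + 1 + i) v).trans ?_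
      rw [ih]
      simp
  obtain ⟨i, rfl⟩ := Nat.exists_eq_add_of_le hm
  exact congrFun (key i) x

lemma IsPolyDeg.const {F : Type*} [NormedAddCommGroup F] [NormedSpace ℝ F] (j : ℕ) (c : F) :
    IsPolyDeg n j (fun _ => c) :=
  ⟨contDiff_const, fun x => by simp [iteratedFDeriv_succ_const]⟩

lemma IsPolyDeg.mono {F : Type*} [NormedAddCommGroup F] [NormedSpace ℝ F] {i j : ℕ} (h : i ≤ j)
    {P : Euc n → F} (hP : IsPolyDeg n i P) : IsPolyDeg n j P :=
  ⟨hP.1, fun x => hP.iteratedFDeriv_eq_zero (by omega) x⟩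

lemma IsPolyDeg.add {F : Type*} [NormedAddCommGroup F] [NormedSpace ℝ F] {j : ℕ}
    {P Q : Euc n → F} (hP : IsPolyDeg n j P) (hQ : IsPolyDeg n j Q) :
    IsPolyDeg n j (fun y => P y + Q y) := by
  refine ⟨hP.1.add hQ.1, fun x => ?_⟩
  have := iteratedFDeriv_add_apply (𝕜 := ℝ) (i := j + 1) (x := x)
    (hP.1.contDiffAt.of_le (mod_cast le_top)) (hQ.1.contDiffAt.of_le (mod_cast le_top))
  rw [hP.2, hQ.2, add_zero] at this
  exact this

lemma IsPolyDeg.clm_comp {F G : Type*} [NormedAddCommGroup F] [NormedSpace ℝ F]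
    [NormedAddCommGroup G] [NormedSpace ℝ G] {j : ℕ} {P : Euc n → F} (hP : IsPolyDeg n j P)
    (L : F →L[ℝ] G) : IsPolyDeg n j (fun y => L (P y)) := by
  refine ⟨L.contDiff.comp hP.1, fun x => ?_⟩
  have := L.iteratedFDeriv_comp_left (x := x) (hP.1.contDiffAt) (i := j + 1) (mod_cast le_top)
  rw [hP.2] at this
  change iteratedFDeriv ℝ (j + 1) (L ∘ P) x = 0
  rw [this]
  ext; simp

lemma IsPolyDeg.sum {F ι : Type*} [NormedAddCommGroup F] [NormedSpace ℝ F] {j : ℕ}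
    (s : Finset ι) {P : ι → Euc n → F} (hP : ∀ i ∈ s, IsPolyDeg n j (P i)) :
    IsPolyDeg n j (fun y => ∑ i ∈ s, P i y) := by
  classical
  induction s using Finset.induction_on with
  | empty => simpa using IsPolyDeg.const j (0 : F)
  | insert a s ha ih =>
    simp only [Finset.sum_insert ha]
    exact (hP a (Finset.mem_insert_self _ _)).add
      (ih fun i hi => hP i (Finset.mem_insert_of_mem hi))

lemma IsPolyDeg.comp_add_left {F : Type*} [NormedAddCommGroup F] [NormedSpace ℝ F] {j : ℕ}
    {P : Euc n → F} (hP : IsPolyDeg n j P) (a : Euc n) :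
    IsPolyDeg n j (fun y => P (a + y)) :=
  ⟨hP.1.comp (contDiff_const.add contDiff_id), fun x => by
    rw [iteratedFDeriv_comp_add_left, hP.2]⟩

/-- Evaluating an operator-valued polynomial at its own variable raises the degree by one. -/
lemma IsPolyDeg.apply_self {F : Type*} [NormedAddCommGroup F] [NormedSpace ℝ F] {j : ℕ}
    {R : Euc n → (Euc n →L[ℝ] F)} (hR : IsPolyDeg n j R) :
    IsPolyDeg n (j + 1) (fun y => R y y) := by
  refine ⟨hR.1.clm_apply contDiff_id, fun x => ?_⟩
  rw [← norm_le_zero_iff]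
  refine ((ContinuousLinearMap.id ℝ (Euc n →L[ℝ] F)).norm_iteratedFDeriv_le_of_bilinear
    hR.1 (contDiff_id (n := (⊤ : ℕ∞))) x (n := j + 1 + 1) (mod_cast le_top)).trans (le_of_eq ?_)
  refine mul_eq_zero_of_right _ (Finset.sum_eq_zero fun i _ => ?_)
  by_cases hi : j < i
  · simp [hR.iteratedFDeriv_eq_zero hi]
  · obtain ⟨m, hm⟩ : ∃ m, j + 1 + 1 - i = m + 2 := ⟨j - i, by omega⟩
    have : iteratedFDeriv ℝ (m + 2) (fun y : Euc n => y) x = 0 := by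
      ext v
      rw [iteratedFDeriv_succ_apply_right]
      have hid : (fun y : Euc n => fderiv ℝ (fun y : Euc n => y) y) =
          fun _ => ContinuousLinearMap.id ℝ (Euc n) := funext fun y => fderiv_fun_id
      simp only [hid]
      simp [iteratedFDeriv_succ_const]
    rw [hm]
    change _ * ‖iteratedFDeriv ℝ (m + 2) (fun y : Euc n => y) x‖ = 0
    rw [this]; simp

universe u in
lemma isPolyDeg_multilinear_diag (m : ℕ) {F : Type u} [NormedAddCommGroup F] [NormedSpace ℝ F]
    (q : ContinuousMultilinearMap ℝ (fun _ : Fin m => Euc n) F) :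
    IsPolyDeg n m (fun y => q (fun _ => y)) := by
  induction m generalizing F with
  | zero =>
    have : (fun y => q (fun _ => y)) = fun _ => q 0 := by
      ext y; congr 1; ext i; exact i.elim0
    rw [this]
    exact IsPolyDeg.const 0 _
  | succ m ih =>
    have := (ih q.curryRight).apply_self
    refine (funext fun y => ?_ : (fun y => q fun _ => y) = _) ▸ this
    rw [ContinuousMultilinearMap.curryRight_apply]
    congr 1
    ext i
    refine Fin.lastCases ?_ (fun i => ?_) i <;> simp

lemma IsPolyDeg.taylor {F : Type*} [NormedAddCommGroup F] [NormedSpace ℝ F] [CompleteSpace F]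
    {j : ℕ} {P : Euc n → F} (hP : IsPolyDeg n j P) (y : Euc n) :
    P y = ∑ m ∈ Finset.range (j + 1),
      (m.factorial : ℝ)⁻¹ • iteratedFDeriv ℝ m P 0 (fun _ => y) := by
  have := map_add_eq_sum_add_integral_iteratedFDeriv (n := j) (f := P) (x := 0) (y := y)
    (fun t _ => hP.1.contDiffAt.of_le (mod_cast le_top))
  simpa [hP.2] using this

/-- The radial primitive of an operator-valued polynomial is a polynomial. -/
lemma IsPolyDeg.radial_integral {F : Type*} [NormedAddCommGroup F] [NormedSpace ℝ F]
    [CompleteSpace F] {j : ℕ} {P : Euc n → (Euc n →L[ℝ] F)} (hP : IsPolyDeg n j P) :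
    IsPolyDeg n (j + 1) (fun y => ∫ t in (0 : ℝ)..1, P (t • y) y) := by
  have key : (fun y => ∫ t in (0 : ℝ)..1, P (t • y) y) = fun y =>
      (∑ m ∈ Finset.range (j + 1), ((m.factorial : ℝ)⁻¹ * (m + 1 : ℝ)⁻¹) •
        iteratedFDeriv ℝ m P 0 (fun _ => y)) y := by
    ext y
    have h1 : ∀ t : ℝ, P (t • y) y = ∑ m ∈ Finset.range (j + 1), t ^ m •
        ((m.factorial : ℝ)⁻¹ • iteratedFDeriv ℝ m P 0 (fun _ => y) y) := by
      intro t
      rw [hP.taylor (t • y), sum_apply]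
      refine Finset.sum_congr rfl fun m _ => ?_
      have := (iteratedFDeriv ℝ m P 0).map_smul_univ (fun _ => t) (fun _ => y)
      simp only [Finset.prod_const, Finset.card_univ, Fintype.card_fin] at this
      rw [this, smul_apply, smul_apply, smul_comm]
    simp_rw [h1]
    rw [intervalIntegral.integral_finsetSum (fun m _ => Continuous.intervalIntegrable
      (by fun_prop) _ _), sum_apply]
    refine Finset.sum_congr rfl fun m _ => ?_
    rw [intervalIntegral.integral_smul_const, integral_pow, smul_apply,
      smul_smul]
    congr 1
    simp
    ring
  rw [key]
  refine IsPolyDeg.apply_self (IsPolyDeg.sum _ fun m hm => ?_)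
  have := (isPolyDeg_multilinear_diag m (iteratedFDeriv ℝ m P 0)).clm_comp
    (((m.factorial : ℝ)⁻¹ * (m + 1 : ℝ)⁻¹) • ContinuousLinearMap.id ℝ (Euc n →L[ℝ] F))
  exact IsPolyDeg.mono (by simp at hm; omega) this

end Polynomials

section WeakGradient

variable {n : ℕ} {V : Type*} [NormedAddCommGroup V] [NormedSpace ℝ V]

/-- `G` is the weak gradient of `w`. -/
def HasWeakGrad (w : Euc n → V) (G : Euc n → (Euc n →L[ℝ] V)) : Prop :=
  ∀ φ : Euc n → ℝ, IsTestFun n φ → ∀ e : Euc n,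
    ∫ y, (fderiv ℝ φ y e) • w y = -∫ y, φ y • G y e

lemma IsTestFun.comp_const_sub {φ : Euc n → ℝ} (hφ : IsTestFun n φ) (x : Euc n) :
    IsTestFun n (fun t => φ (x - t)) :=
  ⟨hφ.1.comp (contDiff_const.sub contDiff_id), hφ.2.comp_homeomorph (Homeomorph.subLeft x)⟩

lemma IsTestFun.comp_const_add {φ : Euc n → ℝ} (hφ : IsTestFun n φ) (x : Euc n) :
    IsTestFun n (fun t => φ (x + t)) :=
  ⟨hφ.1.comp (contDiff_const.add contDiff_id), hφ.2.comp_homeomorph (Homeomorph.addLeft x)⟩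

lemma IsTestFun.comp_smul {φ : Euc n → ℝ} (hφ : IsTestFun n φ) {s : ℝ} (hs : s ≠ 0) :
    IsTestFun n (fun t => φ (s • t)) :=
  ⟨hφ.1.comp (contDiff_const_smul s), hφ.2.comp_homeomorph (Homeomorph.smulOfNeZero s hs)⟩

/-- The mollification of a function with vanishing weak gradient is constant. -/
lemma convolution_eq_of_hasWeakGrad_zero {c : Euc n → V} (hc : LocallyIntegrable c)
    (h : HasWeakGrad c 0) {ρ : Euc n → ℝ} (hρ : IsTestFun n ρ) (x y : Euc n) :
    (convolution ρ c (ContinuousLinearMap.lsmul ℝ ℝ) volume) x =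
      (convolution ρ c (ContinuousLinearMap.lsmul ℝ ℝ) volume) y := by
  simp_rw [← convolution_flip (L := ContinuousLinearMap.lsmul ℝ ℝ) (f := ρ) (g := c)]
  have hd := fun x₀ => hρ.2.hasFDerivAt_convolution_right (μ := volume)
    (ContinuousLinearMap.lsmul ℝ ℝ : ℝ →L[ℝ] V →L[ℝ] V).flip hc (hρ.1.of_le (mod_cast le_top)) x₀
  refine is_const_of_fderiv_eq_zero (𝕜 := ℝ) (fun x₀ => (hd x₀).differentiableAt) (fun x₀ => ?_) x y
  rw [(hd x₀).fderiv]
  ext e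
  rw [convolution_precompR_apply _ hc (hρ.2.fderiv ℝ) (hρ.1.continuous_fderiv (by simp))]
  have := h _ (hρ.comp_const_sub x₀) e
  simp only [Pi.zero_apply, zero_apply, smul_zero, integral_zero, neg_zero] at this
  simp only [convolution, ContinuousLinearMap.flip_apply, ContinuousLinearMap.lsmul_apply,
    zero_apply]
  rw [← neg_eq_zero, ← integral_neg, ← this]
  refine integral_congr_ae (Eventually.of_forall fun t => ?_)
  simp only [← neg_smul]
  congr 1
  have h1 : HasFDerivAt (fun t => ρ (x₀ - t))
      ((fderiv ℝ ρ (x₀ - t)).comp (-ContinuousLinearMap.id ℝ (Euc n))) t :=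
    ((hρ.1.differentiable (by simp)) (x₀ - t)).hasFDerivAt.comp t
      ((hasFDerivAt_id t).const_sub x₀)
  rw [h1.fderiv]
  simp

/-- A locally integrable function whose weak gradient vanishes is almost everywhere constant. -/
lemma ae_eq_const_of_hasWeakGrad_zero [CompleteSpace V] {c : Euc n → V} (hc : LocallyIntegrable c)
    (h : HasWeakGrad c 0) : ∃ a : V, ∀ᵐ y, c y = a := by
  let φ : ℕ → ContDiffBump (0 : Euc n) := fun k =>
    ⟨1 / ((k : ℝ) + 1), 2 * (1 / ((k : ℝ) + 1)), by positivity, by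
      have : 0 < 1 / ((k : ℝ) + 1) := by positivity
      linarith⟩
  have hφ : Tendsto (fun k => (φ k).rOut) atTop (𝓝 0) := by
    have := (tendsto_one_div_add_atTop_nhds_zero_nat (𝕜 := ℝ)).const_mul 2
    rwa [mul_zero] at this
  have hae := ContDiffBump.ae_convolution_tendsto_right_of_locallyIntegrable (μ := volume)
    (K := 2) hφ (Eventually.of_forall fun k => le_rfl) hc
  obtain ⟨y₀, hy₀⟩ := hae.exists
  refine ⟨c y₀, hae.mono fun y hy => tendsto_nhds_unique hy (hy₀.congr fun k => ?_)⟩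
  exact convolution_eq_of_hasWeakGrad_zero hc h
    ⟨(φ k).contDiff_normed, (φ k).hasCompactSupport_normed⟩ _ _

end WeakGradient

section Dilation

variable {n : ℕ} {V : Type*} [NormedAddCommGroup V] [NormedSpace ℝ V]

lemma IsTestFun.integrable_smul {φ : Euc n → ℝ} (hφ : IsTestFun n φ) {w : Euc n → V}
    (hw : LocallyIntegrable w) : Integrable (fun y => φ y • w y) :=
  hw.integrable_smul_left_of_hasCompactSupport hφ.1.continuous hφ.2

lemma IsTestFun.fderiv_apply {φ : Euc n → ℝ} (hφ : IsTestFun n φ) (e : Euc n) :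
    IsTestFun n (fun y => fderiv ℝ φ y e) :=
  ⟨(hφ.1.fderiv_right (m := (⊤ : ℕ∞)) (by simp)).clm_apply contDiff_const,
    hφ.2.fderiv_apply ℝ e⟩

lemma IsTestFun.mul_left {φ : Euc n → ℝ} (hφ : IsTestFun n φ) {f : Euc n → ℝ}
    (hf : ContDiff ℝ (⊤ : ℕ∞) f) : IsTestFun n (fun y => f y * φ y) :=
  ⟨hf.mul hφ.1, hφ.2.mul_left⟩

lemma locallyIntegrable_apply_self {G : Euc n → (Euc n →L[ℝ] V)} (hG : LocallyIntegrable G)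
    {A : Euc n → Euc n} (hA : Continuous A) : LocallyIntegrable (fun y => G y (A y)) := by
  rw [locallyIntegrable_iff] at hG ⊢
  intro K hK
  obtain ⟨C, hC⟩ := hK.exists_bound_of_continuousOn hA.continuousOn
  refine ((hG K hK).norm.mul_const C).mono' ?_ ?_
  · exact (ContinuousLinearMap.id ℝ (Euc n →L[ℝ] V)).aestronglyMeasurable_comp₂
      (hG K hK).aestronglyMeasurable hA.aestronglyMeasurable
  · refine (ae_restrict_iff' hK.measurableSet).2 (Eventually.of_forall fun y hy => ?_)
    exact (G y).le_opNorm_of_le (hC y hy)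

/-- Testing the weak gradient against the radial vector field `φ(z) z`. -/
lemma HasWeakGrad.integral_radial {w : Euc n → V} {G : Euc n → (Euc n →L[ℝ] V)}
    (hw : LocallyIntegrable w) (hG : LocallyIntegrable G) (h : HasWeakGrad w G)
    {φ : Euc n → ℝ} (hφ : IsTestFun n φ) :
    ∫ z, (n * φ z + fderiv ℝ φ z z) • w z = -∫ z, φ z • G z z := by
  have hcoord : ∀ i : Fin n, ContDiff ℝ (⊤ : ℕ∞) (fun z : Euc n => z i) := fun i =>
    (EuclideanSpace.proj (𝕜 := ℝ) i).contDiff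
  have hψ : ∀ i : Fin n, IsTestFun n (fun z => z i * φ z) := fun i => hφ.mul_left (hcoord i)
  have hsum : ∀ z : Euc n, ∑ i, z i • stdVec n i = z := fun z => by
    simpa [stdVec] using (EuclideanSpace.basisFun (Fin n) ℝ).sum_repr z
  have hd : ∀ i z, fderiv ℝ (fun z : Euc n => z i * φ z) z (stdVec n i) =
      φ z + z i * fderiv ℝ φ z (stdVec n i) := by
    intro i z
    have h1 := ((EuclideanSpace.proj (𝕜 := ℝ) i).hasFDerivAt (x := z)).mul
      (hφ.1.differentiable (by simp) z).hasFDerivAt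
    have h2 : fderiv ℝ (fun z : Euc n => z i * φ z) z = _ := h1.fderiv
    rw [h2]
    simp [stdVec]
    ring
  calc ∫ z, (n * φ z + fderiv ℝ φ z z) • w z
      = ∫ z, ∑ i, (fderiv ℝ (fun z : Euc n => z i * φ z) z (stdVec n i)) • w z := by
        refine integral_congr_ae (Eventually.of_forall fun z => ?_)
        simp only [hd, ← Finset.sum_smul, Finset.sum_add_distrib]
        congr 2
        · simp
        · conv_lhs => rw [← hsum z, map_sum, hsum z]
          simp
    _ = ∑ i, -∫ z, (z i * φ z) • G z (stdVec n i) := by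
        rw [integral_finsetSum _ fun i _ => ((hψ i).fderiv_apply _).integrable_smul hw]
        exact Finset.sum_congr rfl fun i _ => h _ (hψ i) _
    _ = -∫ z, φ z • G z z := by
        rw [Finset.sum_neg_distrib, ← integral_finsetSum _ fun i _ => (hψ i).integrable_smul
          (locallyIntegrable_apply_self hG continuous_const)]
        congr 1
        refine integral_congr_ae (Eventually.of_forall fun z => ?_)
        dsimp only
        conv_rhs => rw [← hsum z]
        rw [map_sum, Finset.smul_sum]
        refine Finset.sum_congr rfl fun i _ => ?_
        rw [map_smul, hsum, smul_smul, mul_comm]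

lemma hasDerivAt_integral_comp_smul {w : Euc n → V} (hw : LocallyIntegrable w)
    {φ : Euc n → ℝ} (hφ : IsTestFun n φ) {τ : ℝ} (hτ : 0 < τ) :
    HasDerivAt (fun τ : ℝ => ∫ z, φ (τ • z) • w z) (∫ z, (fderiv ℝ φ (τ • z) z) • w z) τ := by
  obtain ⟨R, hR⟩ := hφ.2.isCompact.isBounded.subset_closedBall 0
  obtain ⟨M, hM⟩ := (hφ.2.fderiv ℝ).exists_bound_of_continuous (hφ.1.continuous_fderiv (by simp))
  have hM0 : 0 ≤ M := (norm_nonneg _).trans (hM 0)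
  let B : Set (Euc n) := closedBall 0 (2 * R / τ)
  have hwB : IntegrableOn w B := hw.integrableOn_isCompact (isCompact_closedBall _ _)
  have hmeas : AEStronglyMeasurable w := hw.aestronglyMeasurable
  have hcφ : Continuous φ := hφ.1.continuous
  refine (hasDerivAt_integral_of_dominated_loc_of_deriv_le (s := ball τ (τ / 2))
    (bound := B.indicator fun z => M * (2 * R / τ) * ‖w z‖)
    (F' := fun τ z => (fderiv ℝ φ (τ • z) z) • w z)
    (ball_mem_nhds _ (by positivity)) ?_ ?_ ?_ ?_ ?_ ?_).2
  · exact Eventually.of_forall fun t =>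
      (hcφ.comp (continuous_const_smul t)).aestronglyMeasurable.smul hmeas
  · exact (hφ.comp_smul hτ.ne').integrable_smul hw
  · exact (Continuous.aestronglyMeasurable (by
      have := hφ.1.continuous_fderiv (by simp)
      fun_prop)).smul hmeas
  · refine Eventually.of_forall fun z t ht => ?_
    have ht' : τ / 2 < t := by
      rw [Real.ball_eq_Ioo] at ht; linarith [ht.1]
    by_cases hz : z ∈ B
    · rw [Set.indicator_of_mem hz, norm_smul]
      gcongr
      refine ((fderiv ℝ φ (t • z)).le_opNorm z).trans ?_
      gcongr
      · exact hM _
      · simpa [B] using hz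
    · rw [Set.indicator_of_notMem hz]
      have : t • z ∉ tsupport φ := fun hmem => hz (by
        have := hR hmem
        rw [mem_closedBall_zero_iff, norm_smul, Real.norm_of_nonneg (by linarith)] at this
        rw [mem_closedBall_zero_iff, le_div_iff₀ hτ]
        nlinarith [norm_nonneg z])
      rw [image_eq_zero_of_notMem_tsupport (fun h => this (tsupport_fderiv_subset ℝ h))]
      simp
  · exact (integrable_indicator_iff measurableSet_closedBall).2 (hwB.norm.const_mul _)
  · refine Eventually.of_forall fun z t _ => ?_
    have h1 : HasDerivAt (fun t : ℝ => t • z) z t := by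
      simpa using (hasDerivAt_id t).smul_const z
    exact (((hφ.1.differentiable (by simp) (t • z)).hasFDerivAt.comp_hasDerivAt t h1)).smul_const _

lemma integral_smul_comp_smul (φ : Euc n → ℝ) (w : Euc n → V) {t : ℝ} (ht : 0 < t) :
    ∫ y, φ y • w (t • y) = (t ^ n)⁻¹ • ∫ z, φ (t⁻¹ • z) • w z := by
  have := Measure.integral_comp_smul (volume : Measure (Euc n)) (fun z => φ (t⁻¹ • z) • w z) t
  simp only [smul_smul, inv_mul_cancel₀ ht.ne', one_smul] at this
  rw [this, finrank_euclideanSpace_fin, abs_of_pos (by positivity)]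

lemma HasWeakGrad.hasDerivAt_dilation {w : Euc n → V} {G : Euc n → (Euc n →L[ℝ] V)}
    (hw : LocallyIntegrable w) (hG : LocallyIntegrable G) (h : HasWeakGrad w G)
    {φ : Euc n → ℝ} (hφ : IsTestFun n φ) {t : ℝ} (ht : 0 < t) :
    HasDerivAt (fun t : ℝ => ∫ y, φ y • w (t • y)) (∫ y, φ y • G (t • y) y) t := by
  have hφt := hφ.comp_smul (inv_ne_zero ht.ne')
  have h1 : HasDerivAt (fun t : ℝ => (t ^ n)⁻¹ • ∫ z, φ (t⁻¹ • z) • w z) _ t :=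
    ((hasDerivAt_pow n t).fun_inv (by positivity)).smul
      ((hasDerivAt_integral_comp_smul hw hφ (inv_pos.2 ht)).scomp t (hasDerivAt_inv ht.ne'))
  have h2 : (fun t : ℝ => ∫ y, φ y • w (t • y)) =ᶠ[𝓝 t]
      fun t : ℝ => (t ^ n)⁻¹ • ∫ z, φ (t⁻¹ • z) • w z := by
    filter_upwards [lt_mem_nhds ht] with s hs using integral_smul_comp_smul φ w hs
  refine (h1.congr_of_eventuallyEq h2).congr_deriv ?_
  have h3 := h.integral_radial hw hG hφt
  have hfd : ∀ z, fderiv ℝ (fun z => φ (t⁻¹ • z)) z z = t⁻¹ * fderiv ℝ φ (t⁻¹ • z) z := by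
    intro z
    have := ((hφ.1.differentiable (by simp) (t⁻¹ • z)).hasFDerivAt).comp z
      ((hasFDerivAt_id (𝕜 := ℝ) z).const_smul t⁻¹)
    have h4 : fderiv ℝ (fun z => φ (t⁻¹ • z)) z = _ := this.fderiv
    rw [h4]; simp
  have h4 : ∫ y, φ y • G (t • y) y = (t ^ n)⁻¹ • t⁻¹ • ∫ z, φ (t⁻¹ • z) • G z z := by
    have := integral_smul_comp_smul φ (fun z => t⁻¹ • G z z) ht
    simp only [map_smul, smul_smul, inv_mul_cancel₀ ht.ne', one_smul] at this
    rw [this, ← integral_smul t⁻¹]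
    simp only [smul_smul, mul_comm]
  have h5 : Integrable fun z => (fderiv ℝ φ (t⁻¹ • z) z) • w z := by
    have : Integrable fun z => t • ((fderiv ℝ (fun z => φ (t⁻¹ • z)) z z) • w z) := by
      refine Integrable.smul t (hw.integrable_smul_left_of_hasCompactSupport ?_ ?_)
      · have := hφt.1.continuous_fderiv (by simp)
        fun_prop
      · exact (hφt.2.fderiv ℝ).mono' (fun z hz => subset_tsupport _ (fun h0 => hz (by simp [h0])))
    refine this.congr (Eventually.of_forall fun z => ?_)
    simp only [hfd, smul_smul]
    rw [← mul_assoc, mul_inv_cancel₀ ht.ne', one_mul]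
  have h6 := hφt.integrable_smul hw
  simp only [hfd, add_smul, mul_smul] at h3
  have h7 : (n : ℝ) • (∫ z, φ (t⁻¹ • z) • w z) + t⁻¹ • (∫ z, (fderiv ℝ φ (t⁻¹ • z) z) • w z) =
      -∫ z, φ (t⁻¹ • z) • G z z := by
    rw [← h3, ← integral_smul, ← integral_smul]
    exact (integral_add (h6.smul (n : ℝ)) (h5.smul t⁻¹)).symm
  have h8 : -(n * t ^ (n - 1)) / (t ^ n) ^ 2 = -((t ^ n)⁻¹ * t⁻¹ * n) := by
    rcases n with _ | n
    · simp
    · rw [Nat.add_sub_cancel]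
      field_simp
      ring
  rw [h4, ← neg_eq_iff_eq_neg.2 h7, h8]
  module

end Dilation

section RadialIntegral

variable {n : ℕ} {V : Type*} [NormedAddCommGroup V] [NormedSpace ℝ V]

lemma setLIntegral_ball_comp_smul (f : Euc n → ℝ≥0∞) {t : ℝ} (ht : 0 < t) (r : ℝ) :
    ∫⁻ y in ball 0 r, f (t • y) = ENNReal.ofReal (t ^ n)⁻¹ * ∫⁻ z in ball 0 (t * r), f z := by
  have hemb : MeasurableEmbedding (fun y : Euc n => t • y) :=
    (Homeomorph.smulOfNeZero t ht.ne').measurableEmbedding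
  have hmap := Measure.map_addHaar_smul (volume : Measure (Euc n)) ht.ne'
  rw [finrank_euclideanSpace_fin, abs_of_pos (by positivity)] at hmap
  have hpre : (fun y : Euc n => t • y) ⁻¹' ball 0 (t * r) = ball 0 r := by
    ext y
    simp [norm_smul, abs_of_pos ht, ht]
  have h1 := hemb.lintegral_map (μ := volume.restrict (ball (0 : Euc n) r)) f
  rw [← h1, ← hpre, ← hemb.restrict_map]
  change ∫⁻ z, f z ∂((Measure.map (t • ·) volume).restrict _) = _
  rw [hmap, Measure.restrict_smul, lintegral_smul_measure, smul_eq_mul]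

/-- The growth condition `∫_{B_r} |G| = O(r^n)`, uniformly for bounded radii. -/
def HasBallGrowth (G : Euc n → (Euc n →L[ℝ] V)) : Prop :=
  ∀ R : ℝ, 0 < R → ∃ C : ℝ≥0∞, C ≠ ⊤ ∧ ∀ r, 0 < r → r ≤ R →
    ∫⁻ y in ball 0 r, ‖G y‖ₑ ≤ C * ENNReal.ofReal (r ^ n)

lemma HasBallGrowth.comp_smul {G : Euc n → (Euc n →L[ℝ] V)} (hg : HasBallGrowth G) {R : ℝ}
    (hR : 0 < R) : ∃ C : ℝ≥0∞, C ≠ ⊤ ∧ ∀ t : ℝ, 0 < t → t ≤ 1 →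
      ∫⁻ y in ball 0 R, ‖G (t • y)‖ₑ ≤ C := by
  obtain ⟨C, hC, h⟩ := hg R hR
  refine ⟨C * ENNReal.ofReal (R ^ n), ENNReal.mul_ne_top hC ENNReal.ofReal_ne_top,
    fun t ht ht1 => ?_⟩
  rw [setLIntegral_ball_comp_smul (fun y => ‖G y‖ₑ) ht]
  calc _ ≤ ENNReal.ofReal (t ^ n)⁻¹ * (C * ENNReal.ofReal ((t * R) ^ n)) := by
        gcongr
        exact h _ (by positivity) (by nlinarith)
    _ = C * (ENNReal.ofReal (t ^ n)⁻¹ * ENNReal.ofReal ((t * R) ^ n)) := by ring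
    _ = _ := by
        rw [← ENNReal.ofReal_mul (by positivity), mul_pow,
          inv_mul_cancel_left₀ (by positivity)]

lemma stronglyMeasurable_ray {G : Euc n → (Euc n →L[ℝ] V)} (hGm : StronglyMeasurable G) :
    StronglyMeasurable (fun q : ℝ × Euc n => G (q.1 • q.2) q.2) :=
  (ContinuousLinearMap.id ℝ (Euc n →L[ℝ] V)).continuous₂.comp_stronglyMeasurable
    ((hGm.comp_measurable (by fun_prop : Measurable fun q : ℝ × Euc n => q.1 • q.2)).prodMk
      measurable_snd.stronglyMeasurable)

lemma HasBallGrowth.integrable_prod {G : Euc n → (Euc n →L[ℝ] V)} (hg : HasBallGrowth G)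
    (hGm : StronglyMeasurable G) {R : ℝ} (hR : 0 < R) :
    Integrable (fun q : ℝ × Euc n => G (q.1 • q.2) q.2)
      ((volume.restrict (Set.Ioc 0 1)).prod (volume.restrict (ball 0 R))) := by
  refine ⟨(stronglyMeasurable_ray hGm).aestronglyMeasurable, ?_⟩
  obtain ⟨C, hC, h⟩ := hg.comp_smul hR
  rw [hasFiniteIntegral_iff_enorm, lintegral_prod _ (stronglyMeasurable_ray hGm).enorm.aemeasurable]
  calc _ ≤ ∫⁻ t in Set.Ioc (0 : ℝ) 1, C * ENNReal.ofReal R := by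
        refine setLIntegral_mono measurable_const fun t ht => ?_
        calc _ ≤ ∫⁻ y in ball 0 R, ‖G (t • y)‖ₑ * ENNReal.ofReal R := by
              refine setLIntegral_mono' measurableSet_ball fun y hy => ?_
              refine ((G (t • y)).le_opENorm y).trans ?_
              gcongr
              rw [← ofReal_norm]
              exact ENNReal.ofReal_le_ofReal (by simpa using (mem_ball_zero_iff.1 hy).le)
          _ = (∫⁻ y in ball 0 R, ‖G (t • y)‖ₑ) * ENNReal.ofReal R :=
              lintegral_mul_const' _ _ ENNReal.ofReal_ne_top
          _ ≤ _ := by gcongr; exact h t ht.1 ht.2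
    _ < ⊤ := by
        simp only [lintegral_const, Measure.restrict_apply MeasurableSet.univ, Set.univ_inter,
          Real.volume_Ioc]
        exact ENNReal.mul_lt_top (ENNReal.mul_lt_top hC.lt_top ENNReal.ofReal_lt_top)
          ENNReal.ofReal_lt_top

/-- `∫₀¹ G(ty) y dt`. -/
noncomputable def radialIntegral (G : Euc n → (Euc n →L[ℝ] V)) (y : Euc n) : V :=
  ∫ t in Set.Ioc (0 : ℝ) 1, G (t • y) y

lemma HasBallGrowth.ae_integrableOn_ray {G : Euc n → (Euc n →L[ℝ] V)} (hg : HasBallGrowth G)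
    (hGm : StronglyMeasurable G) :
    ∀ᵐ y : Euc n, IntegrableOn (fun t : ℝ => G (t • y) y) (Set.Ioc 0 1) := by
  have h : ∀ k : ℕ, ∀ᵐ y : Euc n, y ∈ ball (0 : Euc n) (k + 1) →
      IntegrableOn (fun t : ℝ => G (t • y) y) (Set.Ioc 0 1) := fun k =>
    (ae_restrict_iff' measurableSet_ball).1
      (hg.integrable_prod hGm (by positivity : (0 : ℝ) < k + 1)).prod_left_ae
  filter_upwards [ae_all_iff.2 h] with y hy
  obtain ⟨k, hk⟩ := exists_nat_gt ‖y‖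
  exact hy k (by simpa using hk.trans (lt_add_one _))

lemma HasBallGrowth.locallyIntegrable_radialIntegral {G : Euc n → (Euc n →L[ℝ] V)}
    (hg : HasBallGrowth G) (hGm : StronglyMeasurable G) :
    LocallyIntegrable (radialIntegral G) := by
  rw [locallyIntegrable_iff]
  intro K hK
  obtain ⟨R, hR⟩ := hK.isBounded.subset_ball_lt 0 0
  exact IntegrableOn.mono_set (hg.integrable_prod hGm hR.1).integral_prod_right hR.2

lemma IsTestFun.exists_ball {φ : Euc n → ℝ} (hφ : IsTestFun n φ) :
    ∃ R > 0, ∀ y ∉ ball (0 : Euc n) R, φ y = 0 := by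
  obtain ⟨R, hR⟩ := hφ.2.isCompact.isBounded.subset_ball_lt 0 0
  exact ⟨R, hR.1, fun y hy => image_eq_zero_of_notMem_tsupport fun h => hy (hR.2 h)⟩

lemma HasBallGrowth.integrable_test {G : Euc n → (Euc n →L[ℝ] V)} (hg : HasBallGrowth G)
    (hGm : StronglyMeasurable G) {φ : Euc n → ℝ} (hφ : IsTestFun n φ) :
    Integrable (fun q : ℝ × Euc n => φ q.2 • G (q.1 • q.2) q.2)
      ((volume.restrict (Set.Ioc 0 1)).prod volume) := by
  obtain ⟨R, hR, hφR⟩ := hφ.exists_ball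
  obtain ⟨M, hM⟩ := hφ.2.exists_bound_of_continuous hφ.1.continuous
  have h1 : Integrable (fun q : ℝ × Euc n => φ q.2 • G (q.1 • q.2) q.2)
      ((volume.restrict (Set.Ioc 0 1)).prod (volume.restrict (ball 0 R))) :=
    (hg.integrable_prod hGm hR).bdd_smul M
      (hφ.1.continuous.comp continuous_snd).aestronglyMeasurable
      (Eventually.of_forall fun q => hM _)
  have h2 : (volume.restrict (Set.Ioc (0 : ℝ) 1)).prod (volume.restrict (ball (0 : Euc n) R)) =
      ((volume.restrict (Set.Ioc (0 : ℝ) 1)).prod volume).restrict (Set.univ ×ˢ ball 0 R) := by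
    rw [← Measure.prod_restrict, Measure.restrict_univ]
  rw [h2] at h1
  refine (integrableOn_iff_integrable_of_support_subset fun q hq => ?_).1 h1
  refine ⟨trivial, by_contra fun h => hq ?_⟩
  simp [hφR _ h]

lemma HasWeakGrad.tendsto_dilation {w : Euc n → V} {G : Euc n → (Euc n →L[ℝ] V)}
    (h : HasWeakGrad w G) (hg : HasBallGrowth G) {φ : Euc n → ℝ} (hφ : IsTestFun n φ)
    (e : Euc n) :
    Tendsto (fun s : ℝ => ∫ y, (fderiv ℝ φ y e) • w (s • y)) (𝓝[>] 0) (𝓝 0) := by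
  obtain ⟨R, hR, hφR⟩ := hφ.exists_ball
  obtain ⟨M, hM⟩ := hφ.2.exists_bound_of_continuous hφ.1.continuous
  have hM0 : 0 ≤ M := (norm_nonneg _).trans (hM 0)
  obtain ⟨C, hC, hCb⟩ := hg.comp_smul hR
  have key : ∀ s : ℝ, 0 < s → ∫ y, (fderiv ℝ φ y e) • w (s • y) =
      -(s • ∫ y, φ y • G (s • y) e) := by
    intro s hs
    have hfd : ∀ z, fderiv ℝ (fun z => φ (s⁻¹ • z)) z e = s⁻¹ * fderiv ℝ φ (s⁻¹ • z) e := by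
      intro z
      have := ((hφ.1.differentiable (by simp) (s⁻¹ • z)).hasFDerivAt).comp z
        ((hasFDerivAt_id (𝕜 := ℝ) z).const_smul s⁻¹)
      have h4 : fderiv ℝ (fun z => φ (s⁻¹ • z)) z = _ := this.fderiv
      rw [h4]; simp
    have h1 := h _ (hφ.comp_smul (inv_ne_zero hs.ne')) e
    simp only [hfd, mul_smul] at h1
    rw [integral_smul, inv_smul_eq_iff₀ hs.ne'] at h1
    rw [integral_smul_comp_smul (fun y => fderiv ℝ φ y e) w hs, h1,
      integral_smul_comp_smul φ (fun z => G z e) hs]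
    module
  have bound : ∀ s : ℝ, 0 < s → s ≤ 1 → ‖∫ y, φ y • G (s • y) e‖ ≤ M * ‖e‖ * C.toReal := by
    intro s hs hs1
    have h1 : ‖∫ y, φ y • G (s • y) e‖ₑ ≤ ENNReal.ofReal (M * ‖e‖) * C := by
      calc _ ≤ ∫⁻ y, ‖φ y • G (s • y) e‖ₑ := enorm_integral_le_lintegral_enorm _
        _ = ∫⁻ y in ball 0 R, ‖φ y • G (s • y) e‖ₑ :=
            (setLIntegral_eq_of_support_subset fun y hy => by_contra fun h => hy (by
              simp [hφR y h])).symm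
        _ ≤ ∫⁻ y in ball 0 R, ENNReal.ofReal (M * ‖e‖) * ‖G (s • y)‖ₑ := by
            refine lintegral_mono fun y => ?_
            rw [← ofReal_norm, ← ofReal_norm (G (s • y)), ← ENNReal.ofReal_mul (by positivity)]
            refine ENNReal.ofReal_le_ofReal ?_
            rw [norm_smul, mul_assoc, mul_comm ‖e‖]
            exact mul_le_mul (hM y) ((G (s • y)).le_opNorm e) (norm_nonneg _) hM0
        _ = ENNReal.ofReal (M * ‖e‖) * ∫⁻ y in ball 0 R, ‖G (s • y)‖ₑ :=
            lintegral_const_mul' _ _ ENNReal.ofReal_ne_top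
        _ ≤ _ := by gcongr; exact hCb s hs hs1
    have h2 := ENNReal.toReal_mono (ENNReal.mul_ne_top ENNReal.ofReal_ne_top hC) h1
    rwa [ENNReal.toReal_mul, ENNReal.toReal_ofReal (by positivity), toReal_enorm] at h2
  refine squeeze_zero_norm' (a := fun s => s * (M * ‖e‖ * C.toReal)) ?_ ?_
  · filter_upwards [Ioc_mem_nhdsGT (zero_lt_one' ℝ)] with s hs
    rw [key s hs.1, norm_neg, norm_smul, Real.norm_of_nonneg hs.1.le]
    exact mul_le_mul_of_nonneg_left (bound s hs.1 hs.2) hs.1.le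
  · have : Tendsto (fun s : ℝ => s * (M * ‖e‖ * C.toReal)) (𝓝 0) (𝓝 (0 * (M * ‖e‖ * C.toReal))) :=
      tendsto_id.mul_const _
    rw [zero_mul] at this
    exact this.mono_left nhdsWithin_le_nhds

/-- A function is recovered, up to a constant, by integrating its weak gradient along rays. -/
theorem HasWeakGrad.ae_eq_radialIntegral [CompleteSpace V] {w : Euc n → V}
    {G : Euc n → (Euc n →L[ℝ] V)} (hw : LocallyIntegrable w) (hG : LocallyIntegrable G)
    (hGm : StronglyMeasurable G) (h : HasWeakGrad w G) (hg : HasBallGrowth G) :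
    ∃ a : V, ∀ᵐ y, w y = a + radialIntegral G y := by
  have hrad := hg.locallyIntegrable_radialIntegral hGm
  suffices hc : HasWeakGrad (fun y => w y - radialIntegral G y) 0 by
    obtain ⟨a, ha⟩ := ae_eq_const_of_hasWeakGrad_zero (hw.sub hrad) hc
    exact ⟨a, ha.mono fun y hy => sub_eq_iff_eq_add.1 hy⟩
  intro ψ hψ e
  simp only [Pi.zero_apply, zero_apply, smul_zero, integral_zero, neg_zero]
  have hφ := hψ.fderiv_apply e
  set φ := fun y => fderiv ℝ ψ y e with hφdef
  let K : ℝ → V := fun t => ∫ y, φ y • G (t • y) y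
  have hint := hg.integrable_test hGm hφ
  have hK : IntegrableOn K (Set.Ioc 0 1) := hint.integral_prod_left
  have hKint : ∫ y, φ y • radialIntegral G y = ∫ t in Set.Ioc (0 : ℝ) 1, K t := by
    simp only [K]
    rw [integral_integral_swap hint]
    simp only [radialIntegral, integral_smul]
  have hftc : ∀ s ∈ Set.Ioc (0 : ℝ) 1, ∫ y, φ y • w (s • y) =
      (∫ y, φ y • w y) - ∫ t in s..1, K t := by
    intro s hs
    rw [intervalIntegral.integral_eq_sub_of_hasDerivAt
      (f := fun t : ℝ => ∫ y, φ y • w (t • y))]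
    · simp
    · intro t ht
      rw [Set.uIcc_of_le hs.2] at ht
      exact h.hasDerivAt_dilation hw hG hφ (hs.1.trans_le ht.1)
    · rw [intervalIntegrable_iff_integrableOn_Ioc_of_le hs.2]
      exact hK.mono_set (Set.Ioc_subset_Ioc_left hs.1.le)
  have hlim : Tendsto (fun s : ℝ => (∫ y, φ y • w y) - ∫ t in s..1, K t) (𝓝[>] 0)
      (𝓝 ((∫ y, φ y • w y) - ∫ t in (0 : ℝ)..1, K t)) := by
    refine tendsto_const_nhds.sub ?_
    have hcont := intervalIntegral.continuousOn_primitive_interval_left (a := (0 : ℝ)) (b := 1)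
      (μ := volume) (f := K) (by
        rw [Set.uIcc_of_le zero_le_one, integrableOn_Icc_iff_integrableOn_Ioc]; exact hK)
    have := (hcont 0 (by simp)).tendsto
    refine this.mono_left ?_
    rw [Set.uIcc_of_le zero_le_one]
    exact nhdsWithin_le_of_mem (mem_of_superset (Ioc_mem_nhdsGT zero_lt_one) Set.Ioc_subset_Icc_self)
  have h0 := tendsto_nhds_unique (hlim.congr' (by
    filter_upwards [Ioc_mem_nhdsGT (zero_lt_one' ℝ)] with s hs using (hftc s hs).symm))
    (h.tendsto_dilation hg hψ e)
  rw [intervalIntegral.integral_of_le zero_le_one, ← hKint] at h0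
  rw [← h0]
  simp only [smul_sub]
  exact integral_sub (hφ.integrable_smul hw) (hφ.integrable_smul hrad)

end RadialIntegral

section Decay

variable {n : ℕ} {F : Type*} [NormedAddCommGroup F]

/-- The model growth `r^{n + jp}` of the `p`-th power of the `L^p` norm over `B_r`. -/
noncomputable def decayGauge (n j : ℕ) (p r : ℝ) : ℝ≥0∞ :=
  ENNReal.ofReal (r ^ n) * ENNReal.ofReal (r ^ j) ^ p

/-- `∫_{B_r(x)} |h|^p = o(r^{n + jp})` as `r ↓ 0`. -/
def HasDecay (n j : ℕ) (p : ℝ) (x : Euc n) (h : Euc n → F) : Prop :=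
  ∀ ε : ℝ≥0∞, 0 < ε → ∃ δ > 0, ∀ r, 0 < r → r < δ →
    ∫⁻ y in ball x r, ‖h y‖ₑ ^ p ≤ ε * decayGauge n j p r

lemma memT_iff_hasDecay [NormedSpace ℝ F] {j : ℕ} {p : ℝ} (hp : 1 ≤ p) {f : Euc n → F}
    {x : Euc n} :
    MemT n j p f x ↔ ∃ P, IsPolyDeg n j P ∧ HasDecay n j p x (fun y => f y - P y) := by
  have hp0 : 0 < p := by linarith
  refine exists_congr fun P => and_congr_right fun _ => ?_
  set c := volume (ball (0 : Euc n) 1) with hc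
  have hc0 : c ≠ 0 := (measure_ball_pos volume _ one_pos).ne'
  have hct : c ≠ ⊤ := measure_ball_lt_top.ne
  have key : ∀ (ε : ℝ≥0∞) (r : ℝ), 0 < r →
      (((volume (ball x r))⁻¹ * ∫⁻ y in ball x r, (‖f y - P y‖₊ : ℝ≥0∞) ^ p) ^ (1 / p) /
        ENNReal.ofReal (r ^ (j : ℝ)) ≤ ε ↔
      ∫⁻ y in ball x r, ‖f y - P y‖ₑ ^ p ≤ (ε ^ p * c) * decayGauge n j p r) := by
    intro ε r hr
    rw [ENNReal.div_le_iff (ENNReal.ofReal_pos.2 (by positivity)).ne' ENNReal.ofReal_ne_top,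
      one_div, ENNReal.rpow_inv_le_iff hp0, ENNReal.inv_mul_le_iff
      (measure_ball_pos volume _ hr).ne' measure_ball_lt_top.ne, Real.rpow_natCast,
      ENNReal.mul_rpow_of_nonneg _ _ hp0.le, Measure.addHaar_ball_of_pos _ _ hr,
      finrank_euclideanSpace_fin, decayGauge]
    refine iff_of_eq (congrArg _ ?_)
    rw [← hc]
    ring
  rw [SmallO, ENNReal.tendsto_nhds_zero]
  constructor
  · intro h ε hε
    have hε' : 0 < (ε / c) ^ p⁻¹ :=
      ENNReal.rpow_pos_of_nonneg (ENNReal.div_pos_iff.2 ⟨hε.ne', hct⟩) (by positivity)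
    obtain ⟨δ, hδ, hsub⟩ := mem_nhdsGT_iff_exists_Ioo_subset.1 (h _ hε')
    refine ⟨δ, hδ, fun r hr hrδ => ((key _ r hr).1 (hsub ⟨hr, hrδ⟩)).trans ?_⟩
    rw [ENNReal.rpow_inv_rpow hp0.ne', ENNReal.div_mul_cancel hc0 hct]
  · intro h ε hε
    obtain ⟨δ, hδ, hsub⟩ := h (ε ^ p * c)
      (pos_iff_ne_zero.2 (mul_ne_zero (ENNReal.rpow_pos_of_nonneg hε hp0.le).ne' hc0))
    filter_upwards [Ioo_mem_nhdsGT hδ] with r hr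
    exact (key ε r hr.1).2 (hsub r hr.1 hr.2)

lemma HasDecay.congr_ae {j : ℕ} {p : ℝ} {x : Euc n} {h h' : Euc n → F}
    (hh : HasDecay n j p x h) (heq : h =ᵐ[volume] h') : HasDecay n j p x h' := by
  intro ε hε
  obtain ⟨δ, hδ, hb⟩ := hh ε hε
  refine ⟨δ, hδ, fun r hr hrδ => (lintegral_congr_ae ?_).symm.trans_le (hb r hr hrδ)⟩
  filter_upwards [ae_restrict_of_ae heq] with y hy
  rw [hy]

lemma HasDecay.of_enorm_le {F' : Type*} [NormedAddCommGroup F'] {j : ℕ} {p : ℝ} (hp : 1 ≤ p)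
    {x : Euc n} {h : Euc n → F} {h' : Euc n → F'} (hh : HasDecay n j p x h) {K : ℝ≥0∞}
    (hK : K ≠ ⊤) (hle : ∀ y, ‖h' y‖ₑ ≤ K * ‖h y‖ₑ) : HasDecay n j p x h' := by
  have hp0 : 0 ≤ p := by linarith
  have hKp : K ^ p ≠ ⊤ := ENNReal.rpow_ne_top_of_nonneg hp0 hK
  intro ε hε
  obtain ⟨δ, hδ, hb⟩ := hh (ε / K ^ p) (ENNReal.div_pos_iff.2 ⟨hε.ne', hKp⟩)
  refine ⟨δ, hδ, fun r hr hrδ => ?_⟩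
  calc ∫⁻ y in ball x r, ‖h' y‖ₑ ^ p ≤ ∫⁻ y in ball x r, K ^ p * ‖h y‖ₑ ^ p := by
        refine lintegral_mono fun y => ?_
        rw [← ENNReal.mul_rpow_of_nonneg _ _ hp0]
        exact ENNReal.rpow_le_rpow (hle y) hp0
    _ = K ^ p * ∫⁻ y in ball x r, ‖h y‖ₑ ^ p := lintegral_const_mul' _ _ hKp
    _ ≤ K ^ p * (ε / K ^ p * decayGauge n j p r) := by gcongr; exact hb r hr hrδ
    _ ≤ ε * decayGauge n j p r := by
        rw [← mul_assoc]
        gcongr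
        exact ENNReal.mul_div_le

lemma HasDecay.add {j : ℕ} {p : ℝ} (hp : 1 ≤ p) {x : Euc n} {h h' : Euc n → F}
    (hm : AEStronglyMeasurable h) (hh : HasDecay n j p x h) (hh' : HasDecay n j p x h') :
    HasDecay n j p x (fun y => h y + h' y) := by
  have hp0 : 0 ≤ p := by linarith
  set K : ℝ≥0∞ := 2 ^ (p - 1) with hKdef
  have hK : K ≠ ⊤ := ENNReal.rpow_ne_top_of_nonneg (by linarith) (by simp)
  have hK2 : K * 2 ≠ ⊤ := ENNReal.mul_ne_top hK (by simp)
  intro ε hε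
  have hε' := ENNReal.div_pos_iff.2 ⟨hε.ne', hK2⟩
  obtain ⟨δ, hδ, hb⟩ := hh _ hε'
  obtain ⟨δ', hδ', hb'⟩ := hh' _ hε'
  refine ⟨min δ δ', lt_min hδ hδ', fun r hr hrδ => ?_⟩
  calc ∫⁻ y in ball x r, ‖h y + h' y‖ₑ ^ p
      ≤ ∫⁻ y in ball x r, K * (‖h y‖ₑ ^ p + ‖h' y‖ₑ ^ p) := lintegral_mono fun y =>
        (ENNReal.rpow_le_rpow (enorm_add_le _ _) hp0).trans
          (ENNReal.rpow_add_le_mul_rpow_add_rpow _ _ hp)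
    _ = K * ((∫⁻ y in ball x r, ‖h y‖ₑ ^ p) + ∫⁻ y in ball x r, ‖h' y‖ₑ ^ p) := by
        rw [lintegral_const_mul' _ _ hK, lintegral_add_left' (hm.enorm.pow_const p).restrict]
    _ ≤ K * (ε / (K * 2) * decayGauge n j p r + ε / (K * 2) * decayGauge n j p r) := by
        gcongr
        · exact hb r hr (hrδ.trans_le (min_le_left _ _))
        · exact hb' r hr (hrδ.trans_le (min_le_right _ _))
    _ = K * 2 * (ε / (K * 2)) * decayGauge n j p r := by ring
    _ ≤ ε * decayGauge n j p r := by gcongr; exact ENNReal.mul_div_le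

lemma HasDecay.sum {ι : Type*} {j : ℕ} {p : ℝ} (hp : 1 ≤ p) {x : Euc n} (s : Finset ι)
    {h : ι → Euc n → F} (hm : ∀ i ∈ s, AEStronglyMeasurable (h i))
    (hh : ∀ i ∈ s, HasDecay n j p x (h i)) :
    HasDecay n j p x (fun y => ∑ i ∈ s, h i y) := by
  classical
  induction s using Finset.induction_on with
  | empty =>
    intro ε _
    refine ⟨1, one_pos, fun r _ _ => ?_⟩
    simp [ENNReal.zero_rpow_of_pos (by linarith : 0 < p)]
  | insert a s ha ih =>
    simp only [Finset.sum_insert ha]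
    exact (hh a (s.mem_insert_self a)).add hp (hm a (s.mem_insert_self a))
      (ih (fun i hi => hm i (Finset.mem_insert_of_mem hi))
        fun i hi => hh i (Finset.mem_insert_of_mem hi))

lemma setLIntegral_ball_add_left (f : Euc n → ℝ≥0∞) (x : Euc n) (r : ℝ) :
    ∫⁻ y in ball 0 r, f (x + y) = ∫⁻ y in ball x r, f y := by
  have := (measurePreserving_add_left (volume : Measure (Euc n)) x).setLIntegral_comp_preimage_emb
    (measurableEmbedding_addLeft x) f (ball x r)
  rw [← this]
  congr 2
  ext y
  simp

lemma hasDecay_zero_comp_add_left {j : ℕ} {p : ℝ} {x : Euc n} {h : Euc n → F} :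
    HasDecay n j p 0 (fun y => h (x + y)) ↔ HasDecay n j p x h := by
  simp only [HasDecay, setLIntegral_ball_add_left (fun y => ‖h y‖ₑ ^ p)]

lemma lintegral_rpow_le_of_isProbabilityMeasure {α : Type*} [MeasurableSpace α] {μ : Measure α}
    [IsProbabilityMeasure μ] {p : ℝ} (hp : 1 ≤ p) {f : α → ℝ≥0∞} (hf : AEMeasurable f μ) :
    (∫⁻ a, f a ∂μ) ^ p ≤ ∫⁻ a, f a ^ p ∂μ := by
  have h := eLpNorm'_le_eLpNorm'_of_exponent_le one_pos hp μ hf.aestronglyMeasurable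
  simp only [eLpNorm', enorm_eq_self, ENNReal.rpow_one, div_one, one_div] at h
  exact (ENNReal.le_rpow_inv_iff (by linarith)).1 h

end Decay

section RadialDecay

variable {n : ℕ} {V : Type*} [NormedAddCommGroup V] [NormedSpace ℝ V]

/-- Radial integration improves the decay at the origin by one order. -/
lemma HasDecay.radial {j : ℕ} {p : ℝ} (hp : 1 ≤ p) {H : Euc n → (Euc n →L[ℝ] V)}
    (hm : StronglyMeasurable H) (hH : HasDecay n j p 0 H) :
    HasDecay n (j + 1) p 0 (radialIntegral H) := by
  have hp0 : 0 ≤ p := by linarith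
  intro ε hε
  obtain ⟨δ, hδ, hb⟩ := hH ε hε
  refine ⟨δ, hδ, fun r hr hrδ => ?_⟩
  have : IsProbabilityMeasure (volume.restrict (Set.Ioc (0 : ℝ) 1)) := ⟨by simp⟩
  have hmeas : Measurable (fun q : Euc n × ℝ => ‖H (q.2 • q.1)‖ₑ) :=
    hm.enorm.comp (measurable_snd.smul measurable_fst)
  have hrp : ENNReal.ofReal r ^ p ≠ ⊤ := ENNReal.rpow_ne_top_of_nonneg hp0 ENNReal.ofReal_ne_top
  calc ∫⁻ y in ball 0 r, ‖radialIntegral H y‖ₑ ^ p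
      ≤ ∫⁻ y in ball 0 r, ENNReal.ofReal r ^ p *
          ∫⁻ t in Set.Ioc (0 : ℝ) 1, ‖H (t • y)‖ₑ ^ p := by
        refine setLIntegral_mono' measurableSet_ball fun y hy => ?_
        have h1 : ‖radialIntegral H y‖ₑ ≤
            ENNReal.ofReal r * ∫⁻ t in Set.Ioc (0 : ℝ) 1, ‖H (t • y)‖ₑ := by
          refine (enorm_integral_le_lintegral_enorm _).trans ?_
          rw [← lintegral_const_mul' _ _ ENNReal.ofReal_ne_top]
          refine lintegral_mono fun t => ((H (t • y)).le_opENorm y).trans ?_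
          rw [mul_comm]
          gcongr
          rw [← ofReal_norm]
          exact ENNReal.ofReal_le_ofReal (mem_ball_zero_iff.1 hy).le
        refine (ENNReal.rpow_le_rpow h1 hp0).trans ?_
        rw [ENNReal.mul_rpow_of_nonneg _ _ hp0]
        gcongr
        exact lintegral_rpow_le_of_isProbabilityMeasure hp
          (hmeas.comp measurable_prodMk_left).aemeasurable
    _ = ENNReal.ofReal r ^ p *
          ∫⁻ t in Set.Ioc (0 : ℝ) 1, ∫⁻ y in ball 0 r, ‖H (t • y)‖ₑ ^ p := by
        rw [lintegral_const_mul' _ _ hrp, lintegral_lintegral_swap]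
        exact (hmeas.pow_const p).aemeasurable
    _ ≤ ENNReal.ofReal r ^ p * ∫⁻ _ in Set.Ioc (0 : ℝ) 1, ε * decayGauge n j p r := by
        refine mul_le_mul' le_rfl (setLIntegral_mono measurable_const fun t ht => ?_)
        have ht0 := ht.1
        rw [setLIntegral_ball_comp_smul (fun y => ‖H y‖ₑ ^ p) ht0]
        calc _ ≤ ENNReal.ofReal (t ^ n)⁻¹ * (ε * decayGauge n j p (t * r)) := by
              gcongr
              exact hb _ (by positivity) (by nlinarith [ht.2])
          _ ≤ ENNReal.ofReal (t ^ n)⁻¹ * (ε * (ENNReal.ofReal ((t * r) ^ n) *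
                ENNReal.ofReal (r ^ j) ^ p)) := by
              rw [decayGauge]
              gcongr
              nlinarith [ht.2]
          _ = ε * (ENNReal.ofReal (t ^ n)⁻¹ * ENNReal.ofReal ((t * r) ^ n)) *
                ENNReal.ofReal (r ^ j) ^ p := by ring
          _ = _ := by
              rw [← ENNReal.ofReal_mul (by positivity), mul_pow,
                inv_mul_cancel_left₀ (by positivity), decayGauge, mul_assoc]
    _ = ε * decayGauge n (j + 1) p r := by
        rw [lintegral_const, measure_univ, mul_one, decayGauge, decayGauge, pow_succ,
          ENNReal.ofReal_mul (by positivity), ENNReal.mul_rpow_of_nonneg _ _ hp0]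
        ring

lemma HasBallGrowth.of_hasDecay_sub {j : ℕ} {p : ℝ} (hp : 1 ≤ p) {G P : Euc n → (Euc n →L[ℝ] V)}
    (hG : LocallyIntegrable G) (hP : Continuous P)
    (hH : HasDecay n j p 0 (fun y => G y - P y)) : HasBallGrowth G := by
  have hp0 : 0 < p := by linarith
  intro R hR
  obtain ⟨δ₀, hδ₀, hb⟩ := hH 1 one_pos
  obtain ⟨M, hM⟩ := (isCompact_closedBall (0 : Euc n) R).exists_bound_of_continuousOn
    hP.continuousOn
  set δ := min δ₀ 1
  have hδ : 0 < δ := lt_min hδ₀ one_pos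
  set c := volume (ball (0 : Euc n) 1)
  have hct : c ≠ ⊤ := measure_ball_lt_top.ne
  set I := ∫⁻ y in ball 0 R, ‖G y‖ₑ
  have hI : I ≠ ⊤ :=
    ((hG.integrableOn_isCompact (isCompact_closedBall 0 R)).mono_set ball_subset_closedBall).2.ne
  refine ⟨(1 + ENNReal.ofReal M) * c + 1 + I / ENNReal.ofReal (δ ^ n), ?_, fun r hr hrR => ?_⟩
  · refine ENNReal.add_ne_top.2 ⟨ENNReal.add_ne_top.2 ⟨ENNReal.mul_ne_top (by simp) hct, by simp⟩,
      ENNReal.div_ne_top hI (ENNReal.ofReal_pos.2 (by positivity)).ne'⟩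
  have hvol : volume (ball (0 : Euc n) r) = ENNReal.ofReal (r ^ n) * c := by
    rw [Measure.addHaar_ball_of_pos _ _ hr, finrank_euclideanSpace_fin]
  rcases lt_or_ge r δ with hrδ | hrδ
  · refine le_trans ?_ (mul_le_mul_left le_self_add _)
    calc ∫⁻ y in ball 0 r, ‖G y‖ₑ
        ≤ ∫⁻ y in ball 0 r, ((1 + ENNReal.ofReal M) + ‖G y - P y‖ₑ ^ p) := by
          refine setLIntegral_mono' measurableSet_ball fun y hy => ?_
          have h1 : ‖G y‖ₑ ≤ ‖G y - P y‖ₑ + ‖P y‖ₑ := by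
            simpa using enorm_add_le (G y - P y) (P y)
          have h2 : ‖P y‖ₑ ≤ ENNReal.ofReal M := by
            rw [← ofReal_norm]
            exact ENNReal.ofReal_le_ofReal (hM y (ball_subset_closedBall (ball_subset_ball hrR hy)))
          have h3 : ‖G y - P y‖ₑ ≤ 1 + ‖G y - P y‖ₑ ^ p := by
            rcases le_total ‖G y - P y‖ₑ 1 with h | h
            · exact h.trans le_self_add
            · exact (ENNReal.le_rpow_self_of_one_le h hp).trans le_add_self
          calc _ ≤ _ := h1
            _ ≤ (1 + ‖G y - P y‖ₑ ^ p) + ENNReal.ofReal M := add_le_add h3 h2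
            _ = _ := by ring
      _ = (1 + ENNReal.ofReal M) * (ENNReal.ofReal (r ^ n) * c) +
            ∫⁻ y in ball 0 r, ‖G y - P y‖ₑ ^ p := by
          rw [lintegral_add_left measurable_const, setLIntegral_const, hvol]
      _ ≤ (1 + ENNReal.ofReal M) * (ENNReal.ofReal (r ^ n) * c) + ENNReal.ofReal (r ^ n) := by
          gcongr
          refine (hb r hr (hrδ.trans_le (min_le_left _ _))).trans ?_
          rw [one_mul, decayGauge]
          refine mul_le_of_le_one_right' (ENNReal.rpow_le_one ?_ hp0.le)
          rw [ENNReal.ofReal_le_one]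
          exact pow_le_one₀ hr.le (hrδ.le.trans (min_le_right _ _))
      _ = _ := by ring
  · refine le_trans ?_ (mul_le_mul_left le_add_self _)
    calc ∫⁻ y in ball 0 r, ‖G y‖ₑ ≤ I := lintegral_mono_set (ball_subset_ball hrR)
      _ = I / ENNReal.ofReal (δ ^ n) * ENNReal.ofReal (δ ^ n) :=
          (ENNReal.div_mul_cancel (ENNReal.ofReal_pos.2 (by positivity)).ne'
            ENNReal.ofReal_ne_top).symm
      _ ≤ _ := by gcongr

/-- If the weak gradient of `w` is `L^p`-Taylor approximable of order `j` at the origin, then `w`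
is so of order `j + 1`. -/
theorem HasWeakGrad.exists_hasDecay_zero [CompleteSpace V] {j : ℕ} {p : ℝ} (hp : 1 ≤ p)
    {w : Euc n → V} {G P : Euc n → (Euc n →L[ℝ] V)} (hw : LocallyIntegrable w)
    (hG : LocallyIntegrable G) (h : HasWeakGrad w G) (hP : IsPolyDeg n j P)
    (hH : HasDecay n j p 0 (fun y => G y - P y)) :
    ∃ Q, IsPolyDeg n (j + 1) Q ∧ HasDecay n (j + 1) p 0 (fun y => w y - Q y) := by
  have hmk := hG.aestronglyMeasurable
  set G' := hmk.mk G with hG'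
  have hGG' : G =ᵐ[volume] G' := hmk.ae_eq_mk
  have hGm : StronglyMeasurable G' := hmk.stronglyMeasurable_mk
  have hGi : LocallyIntegrable G' := hG.congr hGG'
  have hg' : HasWeakGrad w G' := by
    intro φ hφ e
    rw [h φ hφ e]
    congr 1
    refine integral_congr_ae ?_
    filter_upwards [hGG'] with y hy
    rw [hy]
  have hH' : HasDecay n j p 0 (fun y => G' y - P y) :=
    hH.congr_ae (hGG'.mono fun y hy => by simp only [hy])
  have hgr := HasBallGrowth.of_hasDecay_sub hp hGi hP.1.continuous hH'
  obtain ⟨a, ha⟩ := hg'.ae_eq_radialIntegral hw hGi hGm hgr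
  refine ⟨fun y => a + ∫ t in (0 : ℝ)..1, P (t • y) y,
    (IsPolyDeg.const (j + 1) a).add hP.radial_integral, ?_⟩
  refine (HasDecay.radial hp (hGm.sub hP.1.continuous.stronglyMeasurable) hH').congr_ae ?_
  filter_upwards [ha, hgr.ae_integrableOn_ray hGm] with y hy hyi
  have hPi : IntegrableOn (fun t : ℝ => P (t • y) y) (Set.Ioc 0 1) := by
    have hc : Continuous (fun t : ℝ => P (t • y) y) := by
      have := hP.1.continuous
      fun_prop
    exact (hc.integrableOn_Icc).mono_set Set.Ioc_subset_Icc_self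
  rw [hy, intervalIntegral.integral_of_le zero_le_one, add_sub_add_left_eq_sub]
  simp only [radialIntegral]
  rw [← integral_sub hyi hPi]
  rfl

end RadialDecay

section Translation

variable {n : ℕ} {V : Type*} [NormedAddCommGroup V]

lemma locallyIntegrable_comp_add_left {w : Euc n → V} (hw : LocallyIntegrable w) (x : Euc n) :
    LocallyIntegrable (fun y => w (x + y)) := by
  rw [locallyIntegrable_iff]
  intro K hK
  have hK' : IsCompact ((fun y => x + y) '' K) := hK.image (continuous_const_add x)
  have := ((measurePreserving_add_left (volume : Measure (Euc n)) x).integrableOn_comp_preimage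
    (measurableEmbedding_addLeft x)).2 (hw.integrableOn_isCompact hK')
  exact this.mono_set (Set.subset_preimage_image _ _)

variable [NormedSpace ℝ V]

lemma HasWeakGrad.comp_add_left {w : Euc n → V} {G : Euc n → (Euc n →L[ℝ] V)}
    (h : HasWeakGrad w G) (x : Euc n) :
    HasWeakGrad (fun y => w (x + y)) (fun y => G (x + y)) := by
  intro φ hφ e
  have h1 := h _ (hφ.comp_const_add (-x)) e
  simp only [fderiv_comp_add_left] at h1
  rw [← integral_add_left_eq_self _ x, ← integral_add_left_eq_self (fun y => φ (-x + y) • G y e) x]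
    at h1
  simpa only [neg_add_cancel_left] using h1

/-- If the weak gradient of `w` belongs to `t^{j,p}(x)`, then `w` belongs to `t^{j+1,p}(x)`. -/
theorem HasWeakGrad.memT_succ [CompleteSpace V] {j : ℕ} {p : ℝ} (hp : 1 ≤ p) {w : Euc n → V}
    {G : Euc n → (Euc n →L[ℝ] V)} (hw : LocallyIntegrable w) (hG : LocallyIntegrable G)
    (h : HasWeakGrad w G) {x : Euc n} (hx : MemT n j p G x) : MemT n (j + 1) p w x := by
  rw [memT_iff_hasDecay hp] at hx ⊢
  obtain ⟨P, hP, hd⟩ := hx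
  obtain ⟨Q, hQ, hdQ⟩ := (h.comp_add_left x).exists_hasDecay_zero hp
    (locallyIntegrable_comp_add_left hw x) (locallyIntegrable_comp_add_left hG x)
    (hP.comp_add_left x) (hasDecay_zero_comp_add_left.2 hd)
  refine ⟨fun y => Q (-x + y), hQ.comp_add_left (-x), hasDecay_zero_comp_add_left.1 ?_⟩
  simpa only [neg_add_cancel_left] using hdQ

end Translation

section Partials

variable {n : ℕ} {V : Type*} [NormedAddCommGroup V] [NormedSpace ℝ V]

/-- The operator-valued map with partial derivatives `g i`. -/
noncomputable def gradOfPartials (g : Fin n → Euc n → V) (y : Euc n) : Euc n →L[ℝ] V :=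
  ∑ i, ContinuousLinearMap.smulRightL ℝ (Euc n) V (EuclideanSpace.proj i) (g i y)

lemma gradOfPartials_apply (g : Fin n → Euc n → V) (y e : Euc n) :
    gradOfPartials g y e = ∑ i, e i • g i y := by
  simp [gradOfPartials]

lemma locallyIntegrable_sum_clm_comp {F : Type*} [NormedAddCommGroup F] [NormedSpace ℝ F]
    {g : Fin n → Euc n → V} (L : Fin n → V →L[ℝ] F) (hg : ∀ i, LocallyIntegrable (g i)) :
    LocallyIntegrable (fun y => ∑ i, L i (g i y)) :=
  locallyIntegrable_finsetSum _ fun i _ => locallyIntegrable_iff.2 fun _ hK =>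
    (L i).integrable_comp ((hg i).integrableOn_isCompact hK)

lemma locallyIntegrable_gradOfPartials {g : Fin n → Euc n → V}
    (hg : ∀ i, LocallyIntegrable (g i)) : LocallyIntegrable (gradOfPartials g) :=
  locallyIntegrable_sum_clm_comp _ hg

lemma hasWeakGrad_gradOfPartials {w : Euc n → V} {g : Fin n → Euc n → V}
    (hw : LocallyIntegrable w) (hg : ∀ i, LocallyIntegrable (g i))
    (h : ∀ i, ∀ φ : Euc n → ℝ, IsTestFun n φ →
      ∫ y, (fderiv ℝ φ y (stdVec n i)) • w y = -∫ y, φ y • g i y) :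
    HasWeakGrad w (gradOfPartials g) := by
  intro φ hφ e
  have hsum : ∑ i, e i • stdVec n i = e := by
    simpa [stdVec] using (EuclideanSpace.basisFun (Fin n) ℝ).sum_repr e
  calc ∫ y, (fderiv ℝ φ y e) • w y
      = ∫ y, ∑ i, e i • ((fderiv ℝ φ y (stdVec n i)) • w y) := by
        refine integral_congr_ae (Eventually.of_forall fun y => ?_)
        simp only
        conv_lhs => rw [← hsum]
        simp only [map_sum, map_smul, Finset.sum_smul, smul_eq_mul, mul_smul]
    _ = ∑ i, e i • ∫ y, (fderiv ℝ φ y (stdVec n i)) • w y := by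
        rw [integral_finsetSum]
        · simp only [integral_smul]
        · exact fun i _ => ((hφ.fderiv_apply _).integrable_smul hw).smul _
    _ = -∑ i, e i • ∫ y, φ y • g i y := by
        simp only [h _ φ hφ, smul_neg, Finset.sum_neg_distrib]
    _ = -∫ y, ∑ i, e i • (φ y • g i y) := by
        rw [integral_finsetSum]
        · simp only [integral_smul]
        · exact fun i _ => (hφ.integrable_smul (hg i)).smul _
    _ = _ := by
        simp only [gradOfPartials_apply, Finset.smul_sum, smul_comm (φ _)]

lemma memT_gradOfPartials {j : ℕ} {p : ℝ} (hp : 1 ≤ p) {g : Fin n → Euc n → V} {x : Euc n}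
    (hg : ∀ i, LocallyIntegrable (g i)) (hx : ∀ i, MemT n j p (g i) x) :
    MemT n j p (gradOfPartials g) x := by
  simp only [memT_iff_hasDecay hp] at hx ⊢
  choose P hP hd using hx
  refine ⟨gradOfPartials P, IsPolyDeg.sum _ fun i _ => (hP i).clm_comp _, ?_⟩
  have key : (fun y => gradOfPartials g y - gradOfPartials P y) = fun y => ∑ i,
      ContinuousLinearMap.smulRightL ℝ (Euc n) V (EuclideanSpace.proj i) (g i y - P i y) := by
    ext1 y
    simp only [gradOfPartials, map_sub, Finset.sum_sub_distrib]
  rw [key]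
  refine HasDecay.sum hp _ (fun i _ => ?_) fun i _ => (hd i).of_enorm_le hp
    (K := ‖ContinuousLinearMap.smulRightL ℝ (Euc n) V (EuclideanSpace.proj i)‖ₑ)
    enorm_ne_top fun y => ContinuousLinearMap.le_opENorm _ _
  exact (ContinuousLinearMap.continuous _).comp_aestronglyMeasurable
    ((hg i).aestronglyMeasurable.sub (hP i).1.continuous.aestronglyMeasurable)

end Partials

lemma dirDeriv_snoc {n m : ℕ} (I : Fin m → Fin n) (i : Fin n) {φ : Euc n → ℝ}
    (hφ : IsTestFun n φ) (y : Euc n) :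
    dirDeriv n (m + 1) (Fin.snoc I i) φ y =
      dirDeriv n m I (fun z => fderiv ℝ φ z (stdVec n i)) y := by
  have hsnoc : (fun l => stdVec n (Fin.snoc (α := fun _ => Fin n) I i l)) =
      Fin.snoc (α := fun _ => Euc n) (fun l => stdVec n (I l)) (stdVec n i) :=
    Fin.comp_snoc (stdVec n) I i
  have hcd : ContDiff ℝ (⊤ : ℕ∞) (fderiv ℝ φ) := hφ.1.fderiv_right (by simp)
  have hcomp := (ContinuousLinearMap.apply ℝ ℝ (stdVec n i)).iteratedFDeriv_comp_left
    (x := y) hcd.contDiffAt (i := m) (mod_cast le_top)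
  rw [dirDeriv, dirDeriv, hsnoc, iteratedFDeriv_succ_apply_right, Fin.init_snoc, Fin.snoc_last]
  exact (DFunLike.congr_fun hcomp fun l => stdVec n (I l)).symm

/-- The top-order family consists of weak partial derivatives of the family one order below. -/
lemma IsWeakDerivFamily.integral_fderiv_smul {n m : ℕ} {V : Type*} [NormedAddCommGroup V]
    [InnerProductSpace ℝ V] {u : Euc n → V} {v : (Fin m → Fin n) → Euc n → V}
    {v' : (Fin (m + 1) → Fin n) → Euc n → V} (hv : IsWeakDerivFamily n m u v)
    (hv' : IsWeakDerivFamily n (m + 1) u v') (I : Fin m → Fin n) (i : Fin n) {φ : Euc n → ℝ}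
    (hφ : IsTestFun n φ) :
    ∫ y, (fderiv ℝ φ y (stdVec n i)) • v I y =
      -∫ y, φ y • v' (Fin.snoc (α := fun _ => Fin n) I i) y := by
  have h1 := hv.2 I _ (hφ.fderiv_apply (stdVec n i))
  have h2 := hv'.2 (Fin.snoc (α := fun _ => Fin n) I i) φ hφ
  simp only [dirDeriv_snoc I i hφ] at h2
  rw [h1, pow_succ, mul_smul, neg_one_smul] at h2
  exact smul_right_injective V (pow_ne_zero m (neg_ne_zero.2 one_ne_zero)) h2

lemma memT_succ_of_isWeakDerivFamily {n m j : ℕ} {V : Type*} [NormedAddCommGroup V]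
    [InnerProductSpace ℝ V] [CompleteSpace V] {p : ℝ} (hp : 1 ≤ p) {u : Euc n → V}
    {v : (Fin m → Fin n) → Euc n → V} {v' : (Fin (m + 1) → Fin n) → Euc n → V}
    (hv : IsWeakDerivFamily n m u v) (hv' : IsWeakDerivFamily n (m + 1) u v') {x : Euc n}
    (hx : ∀ I, MemT n j p (v' I) x) (I : Fin m → Fin n) : MemT n (j + 1) p (v I) x :=
  (hasWeakGrad_gradOfPartials (hv.1 I) (fun _ => hv'.1 _)
    fun i _ hφ => hv.integral_fderiv_smul hv' I i hφ).memT_succ hp (hv.1 I)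
    (locallyIntegrable_gradOfPartials fun _ => hv'.1 _)
    (memT_gradOfPartials hp (fun _ => hv'.1 _) fun _ => hx _)

/-- Lemma 2.3, Calderón–Zygmund: if `1 ≤ p < n`,
`u ∈ W^{k-1,p}_loc(ℝ^n, V)` (with weak derivative families `v m` of order `m ≤ k-1`),
and `D^{k-1} u ∈ t^{1,p}(x)`, then `D^{k-j} u ∈ t^{j,p}(x)` for `j = 1, …, k`. -/
theorem statement10 (n k : ℕ) (hk : 1 ≤ k) {V : Type*}
    [NormedAddCommGroup V] [InnerProductSpace ℝ V] [FiniteDimensional ℝ V]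
    (p : ℝ) (hp1 : 1 ≤ p) (hpn : p < n)
    (u : Euc n → V) (v : ∀ m : ℕ, (Fin m → Fin n) → Euc n → V)
    (hv : ∀ m : ℕ, m ≤ k - 1 → IsWeakDerivFamily n m u (v m) ∧ ∀ I, LocLp n p (v m I))
    (x : Euc n) (hx : ∀ I, MemT n 1 p (v (k - 1) I) x) :
    ∀ j : ℕ, 1 ≤ j → j ≤ k → ∀ I : Fin (k - j) → Fin n, MemT n j p (v (k - j) I) x := by
  have : CompleteSpace V := FiniteDimensional.complete ℝ V
  intro j hj1
  induction j, hj1 using Nat.le_induction with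
  | base => exact fun _ => hx
  | succ j hj ih =>
    intro hjk
    have hih := ih (by omega)
    have hm : k - j = k - (j + 1) + 1 := by omega
    rw [hm] at hih
    exact memT_succ_of_isWeakDerivFamily hp1 (hv _ (by omega)).1 (hv _ (by omega)).1 hih
end
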